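/- arXiv:1904.10028 — 4 statements merged into one kernel-verified Lean document; each statement's English description precedes it below -/
import Mathlib

section
/- For every integer m ≥ 3, the infinite word r = τ(φ^ω(0)) contains a factor of length P_{m+2} + P_{m+1} + P_m − 1 having period P_{m+1} + P_m, and it contains no factor of length P_{m+2} + P_{m+1} + P_m having period P_{m+1} + P_m, where (P_m) are the Pell numbers. -/
/-- Extension of a morphism (given on letters) to finite words by concatenation. -/
def applyM {α β : Type*} (h : α → List β) (w : List α) : List β := w.flatMap h

/-- The morphism φ on the alphabet {0,1,2}: φ(0)=01, φ(1)=02, φ(2)=022. -/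
def phim : Fin 3 → List (Fin 3) := ![[0,1],[0,2],[0,2,2]]

/-- The morphism τ to the binary alphabet: τ(0)=0, τ(1)=01, τ(2)=011. -/
def taum : Fin 3 → List (Fin 2) := ![[0],[0,1],[0,1,1]]

/-- `phipow n w` is the word φ^n(w). -/
def phipow (n : ℕ) (w : List (Fin 3)) : List (Fin 3) := (applyM phim)^[n] w

/-- `p` is a period of the finite word `w`: `1 ≤ p ≤ |w|` and `w[i] = w[i+p]`
for all valid indices. -/
def IsPeriod {α : Type*} (w : List α) (p : ℕ) : Prop :=
  0 < p ∧ p ≤ w.length ∧ ∀ i : ℕ, i + p < w.length → w[i]? = w[i+p]?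

/-- The Pell numbers: P₀ = 0, P₁ = 1, Pₙ = 2·Pₙ₋₁ + Pₙ₋₂. -/
def pell : ℕ → ℕ
  | 0 => 0
  | 1 => 1
  | (n+2) => 2 * pell (n+1) + pell n

/-- The rotation angle `2 - √2` underlying the word `r`. -/
noncomputable def rotAngle : ℝ := 2 - √2

/-- The contraction factor `1 - √2`, the conjugate of the silver ratio. -/
noncomputable def silverConj : ℝ := 1 - √2

/-- The parity of the integer part of a real number, as a binary letter. -/
noncomputable def floorBit (x : ℝ) : Fin 2 := if Even ⌊x⌋ then 0 else 1

/-- The word of length `L` coding the orbit of `x` under translation by `rotAngle`. -/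
noncomputable def orbitCode (x : ℝ) (L : ℕ) : List (Fin 2) :=
  (List.range L).map fun i : ℕ => floorBit (x + i * rotAngle)

/-- The integer parts accompanying the Pell numbers: `P_k θ - Z_k = (1 - √2)^k`. -/
def pellShift : ℕ → ℤ
  | 0 => -1
  | 1 => 1
  | (n+2) => 2 * pellShift (n+1) + pellShift n

lemma silverConj_sq : silverConj ^ 2 = 2 * silverConj + 1 := by
  unfold silverConj
  nlinarith [Real.sq_sqrt (show (0:ℝ) ≤ 2 by norm_num)]

lemma silverConj_bounds : -(0.4143 : ℝ) < silverConj ∧ silverConj < -0.4142 := by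
  have h1 : (1.4142 : ℝ) < √2 := Real.lt_sqrt_of_sq_lt (by norm_num)
  have h2 : √2 < (1.4143 : ℝ) := (Real.sqrt_lt' (by norm_num)).2 (by norm_num)
  unfold silverConj
  constructor <;> linarith

lemma rotAngle_eq : rotAngle = 1 + silverConj := by
  unfold rotAngle silverConj; ring

lemma silverConj_ne_zero : silverConj ≠ 0 := by
  have := silverConj_bounds; intro h; rw [h] at this; norm_num at this

lemma floorBit_add_two_mul (x : ℝ) (z : ℤ) : floorBit (x + 2 * z) = floorBit x := by
  have : x + 2 * z = x + ((2 * z : ℤ) : ℝ) := by push_cast; ring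
  unfold floorBit
  rw [this, Int.floor_add_intCast]
  simp [Int.even_add]

lemma orbitCode_add_two_mul (x : ℝ) (z : ℤ) (L : ℕ) :
    orbitCode (x + 2 * z) L = orbitCode x L := by
  unfold orbitCode
  refine List.map_congr_left fun i _ => ?_
  rw [← floorBit_add_two_mul (x + i * rotAngle) z]
  ring_nf

lemma orbitCode_append (x : ℝ) (a b : ℕ) :
    orbitCode x (a + b) = orbitCode x a ++ orbitCode (x + a * rotAngle) b := by
  unfold orbitCode
  rw [List.range_add, List.map_append, List.map_map]
  congr 1
  refine List.map_congr_left fun i _ => ?_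
  simp only [Function.comp]
  push_cast
  ring_nf

@[simp] lemma orbitCode_length (x : ℝ) (L : ℕ) : (orbitCode x L).length = L := by
  simp [orbitCode]

lemma orbitCode_getElem? (x : ℝ) (L i : ℕ) (h : i < L) :
    (orbitCode x L)[i]? = some (floorBit (x + i * rotAngle)) := by
  simp [orbitCode, h]

/-- The displacement, modulo 2, of the orbit along the block `τ(c)`. -/
noncomputable def blockShift : Fin 3 → ℝ :=
  ![1 + silverConj, 2 * silverConj, 1 + 3 * silverConj]

/-- The open interval of (centred) starting points whose orbit codes begin with `τ(c)`. -/
noncomputable def blockSet : Fin 3 → Set ℝ :=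
  ![Set.Ioo (-(1 + silverConj) / 2) (-silverConj * (1 + silverConj) / 2),
    Set.Ioo ((1 + silverConj) * (2 - silverConj ^ 2) / 2) ((1 - silverConj) / 2),
    Set.Ioo (-silverConj * (1 + silverConj) / 2) ((1 + silverConj) * (2 - silverConj ^ 2) / 2)]

/-- The image of a word under `τ ∘ φ^n`. -/
def tauPhi (n : ℕ) (w : List (Fin 3)) : List (Fin 2) := applyM taum (phipow n w)

lemma phipow_append (n : ℕ) (u v : List (Fin 3)) :
    phipow n (u ++ v) = phipow n u ++ phipow n v := by
  induction n generalizing u v with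
  | zero => rfl
  | succ n ih =>
    simp only [phipow, Function.iterate_succ_apply] at ih ⊢
    rw [← ih]
    simp [applyM]

lemma tauPhi_append (n : ℕ) (u v : List (Fin 3)) :
    tauPhi n (u ++ v) = tauPhi n u ++ tauPhi n v := by
  simp [tauPhi, phipow_append, applyM]

lemma tauPhi_succ (n : ℕ) (c : Fin 3) : tauPhi (n + 1) [c] = tauPhi n (phim c) := by
  simp [tauPhi, phipow, applyM]

lemma floorBit_of_mem_zero {x : ℝ} (h0 : 0 ≤ x) (h1 : x < 1) : floorBit x = 0 := by
  have : ⌊x⌋ = 0 := Int.floor_eq_iff.2 ⟨by simpa using h0, by simpa using h1⟩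
  simp [floorBit, this]

lemma floorBit_of_mem_one {x : ℝ} (h0 : 1 ≤ x) (h1 : x < 2) : floorBit x = 1 := by
  have : ⌊x⌋ = 1 := Int.floor_eq_iff.2 ⟨by simpa using h0, by push_cast; linarith⟩
  simp [floorBit, this]

/-- The word `w` codes every orbit whose starting point has rescaled coordinate in `S`,
and moves this coordinate by `t` modulo 2. -/
def CodesBlock (n : ℕ) (w : List (Fin 2)) (S : Set ℝ) (t : ℝ) : Prop :=
  (∀ s ∈ S, orbitCode (rotAngle / 2 + silverConj ^ n * s) w.length = w) ∧
  ∃ z : ℤ, w.length * rotAngle = silverConj ^ n * t + 2 * z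

lemma CodesBlock.append {n : ℕ} {w v : List (Fin 2)} {S T : Set ℝ} {t u : ℝ}
    (hw : CodesBlock n w S t) (hv : CodesBlock n v T u) :
    CodesBlock n (w ++ v) {s | s ∈ S ∧ s + t ∈ T} (t + u) := by
  obtain ⟨hw, z, hz⟩ := hw
  obtain ⟨hv, y, hy⟩ := hv
  refine ⟨fun s hs => ?_, z + y, ?_⟩
  · rw [List.length_append, orbitCode_append, hw s hs.1, hz]
    have : rotAngle / 2 + silverConj ^ n * s + (silverConj ^ n * t + 2 * z) =
        rotAngle / 2 + silverConj ^ n * (s + t) + 2 * z := by ring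
    rw [this, orbitCode_add_two_mul, hv _ hs.2]
  · rw [List.length_append]
    push_cast
    rw [add_mul, hz, hy]
    ring

lemma CodesBlock.rescale {n : ℕ} {w : List (Fin 2)} {S T : Set ℝ} {t u : ℝ}
    (h : CodesBlock n w S t) (hST : ∀ s ∈ T, silverConj * s ∈ S) (ht : t = silverConj * u) :
    CodesBlock (n + 1) w T u := by
  obtain ⟨h, z, hz⟩ := h
  refine ⟨fun s hs => ?_, z, ?_⟩
  · rw [← h _ (hST s hs)]
    simp [pow_succ, mul_assoc]
  · rw [hz, ht]; ring

lemma codesBlock_taum (c : Fin 3) : CodesBlock 0 (taum c) (blockSet c) (blockShift c) := by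
  have hb := silverConj_bounds
  have hq := silverConj_sq
  constructor
  · fin_cases c <;> intro s hs <;>
      simp [blockSet, hq] at hs <;>
      simp [taum, orbitCode, List.range_succ, rotAngle_eq]
    · apply floorBit_of_mem_zero <;> nlinarith
    · constructor
      · apply floorBit_of_mem_zero <;> nlinarith
      · apply floorBit_of_mem_one <;> nlinarith
    · refine ⟨?_, ?_, ?_⟩
      · apply floorBit_of_mem_zero <;> nlinarith
      · apply floorBit_of_mem_one <;> nlinarith
      · apply floorBit_of_mem_one <;> nlinarith
  · fin_cases c
    · exact ⟨0, by simp [taum, blockShift, rotAngle_eq]⟩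
    · exact ⟨1, by simp [taum, blockShift, rotAngle_eq]; ring⟩
    · exact ⟨1, by simp [taum, blockShift, rotAngle_eq]; ring⟩

lemma codesBlock_tauPhi (n : ℕ) (c : Fin 3) :
    CodesBlock n (tauPhi n [c]) (blockSet c) (blockShift c) := by
  have hb := silverConj_bounds
  have hq := silverConj_sq
  induction n generalizing c with
  | zero => simpa [tauPhi, phipow, applyM] using codesBlock_taum c
  | succ n ih =>
    rw [tauPhi_succ]
    fin_cases c
    · have : tauPhi n (phim 0) = tauPhi n [0] ++ tauPhi n [1] := by
        rw [← tauPhi_append]; rfl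
      simp only [Fin.zero_eta, this]
      refine ((ih 0).append (ih 1)).rescale (fun s hs => ?_) ?_
      · simp [blockSet, blockShift, hq] at hs ⊢
        refine ⟨⟨?_, ?_⟩, ?_, ?_⟩ <;> nlinarith
      · simp [blockShift]; nlinarith
    · have : tauPhi n (phim 1) = tauPhi n [0] ++ tauPhi n [2] := by
        rw [← tauPhi_append]; rfl
      simp only [Fin.mk_one, this]
      refine ((ih 0).append (ih 2)).rescale (fun s hs => ?_) ?_
      · simp [blockSet, blockShift, hq] at hs ⊢
        refine ⟨⟨?_, ?_⟩, ?_, ?_⟩ <;> nlinarith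
      · simp [blockShift]; nlinarith
    · have : tauPhi n (phim 2) = tauPhi n [0] ++ tauPhi n [2] ++ tauPhi n [2] := by
        rw [← tauPhi_append, ← tauPhi_append]; rfl
      simp only [Fin.reduceFinMk, this]
      refine (((ih 0).append (ih 2)).append (ih 2)).rescale (fun s hs => ?_) ?_
      · simp [blockSet, blockShift, hq] at hs ⊢
        refine ⟨⟨⟨?_, ?_⟩, ?_, ?_⟩, ?_, ?_⟩ <;> nlinarith
      · simp [blockShift]; nlinarith

lemma tauPhi_eq_orbitCode (n : ℕ) :
    tauPhi n [0] = orbitCode (rotAngle / 2) (tauPhi n [0]).length := by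
  have hb := silverConj_bounds
  have := (codesBlock_tauPhi n 0).1 0 (by
    simp [blockSet]; constructor <;> nlinarith)
  simpa using this.symm

lemma pell_mul_rotAngle (k : ℕ) : (pell k : ℝ) * rotAngle = silverConj ^ k + pellShift k := by
  induction k using Nat.twoStepInduction with
  | zero => simp [pell, pellShift]
  | one => simp [pell, pellShift, rotAngle_eq]; ring
  | more n h1 h2 =>
    simp only [pell, pellShift]
    push_cast
    rw [pow_add, silverConj_sq]
    rw [pow_succ] at h2
    linarith

lemma pellShift_odd (k : ℕ) : Odd (pellShift k) := by
  induction k using Nat.twoStepInduction with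
  | zero => decide
  | one => decide
  | more n h1 h2 =>
    simp only [pellShift]
    exact (even_two_mul _).add_odd h1

lemma pell_det (k : ℕ) :
    (pell k * pellShift (k + 1) - pell (k + 1) * pellShift k) ^ 2 = 1 := by
  induction k with
  | zero => simp [pell, pellShift]
  | succ k ih =>
    rw [← ih]
    simp only [pell, pellShift]
    push_cast
    ring

lemma pell_add_odd (k : ℕ) : Odd (pell (k + 1) + pell k) := by
  induction k with
  | zero => decide
  | succ k ih =>
    have : pell (k + 2) + pell (k + 1) = 2 * pell (k + 1) + (pell (k + 1) + pell k) := by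
      simp only [pell]; ring
    rw [this]
    exact (even_two_mul _).add_odd ih

lemma pell_pos (k : ℕ) : 0 < pell (k + 1) := by
  induction k with
  | zero => decide
  | succ k ih =>
    simp only [pell]; omega

/-- Every point is reached within `pell (k + 1)` steps from the interval
`(1 - √2)^k • [-1, √2 - 1]`, and the left part of it needs only `pell k` steps. -/
lemma exists_tower (k : ℕ) (y : ℝ) : ∃ (n : ℕ) (z : ℤ) (t : ℝ),
    y = z + n * rotAngle + silverConj ^ k * t ∧
    ((-1 ≤ t ∧ t ≤ -1 - silverConj ∧ n < pell k) ∨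
      (-1 - silverConj ≤ t ∧ t ≤ -silverConj ∧ n < pell (k + 1))) := by
  have hb := silverConj_bounds
  have hq := silverConj_sq
  induction k with
  | zero =>
    refine ⟨0, ⌊y + 1 + silverConj⌋, y - ⌊y + 1 + silverConj⌋, by simp, Or.inr ⟨?_, ?_, ?_⟩⟩
    · linarith [Int.floor_le (y + 1 + silverConj)]
    · linarith [Int.lt_floor_add_one (y + 1 + silverConj)]
    · decide
  | succ k ih =>
    obtain ⟨n, z, t, rfl, ht⟩ := ih
    have hp := pell_mul_rotAngle (k + 1)
    rw [pow_succ] at hp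
    have hP : pell (k + 1 + 1) = 2 * pell (k + 1) + pell k := rfl
    have key : silverConj * (silverConj - 2) = 1 := by linarith
    rcases ht with ⟨h1, h2, h3⟩ | ⟨h1, h2, h3⟩
    · refine ⟨n + 2 * pell (k + 1), z - 2 * pellShift (k + 1),
        (silverConj - 2) * t - 2, ?_, Or.inr ⟨?_, ?_, ?_⟩⟩
      · push_cast
        rw [pow_succ]
        linear_combination (-2) * hp - silverConj ^ k * t * key
      · nlinarith
      · nlinarith
      · omega
    · by_cases h4 : -1 - 2 * silverConj ≤ t
      · refine ⟨n, z, (silverConj - 2) * t, ?_, ?_⟩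
        · rw [pow_succ]
          linear_combination - silverConj ^ k * t * key
        · by_cases h5 : (silverConj - 2) * t ≤ -1 - silverConj
          · exact Or.inl ⟨by nlinarith, h5, h3⟩
          · exact Or.inr ⟨by linarith, by nlinarith, by omega⟩
      · refine ⟨n + pell (k + 1), z - pellShift (k + 1),
          (silverConj - 2) * t - 1, ?_, Or.inr ⟨?_, ?_, ?_⟩⟩
        · push_cast
          rw [pow_succ]
          linear_combination (-1) * hp - silverConj ^ k * t * key
        · nlinarith
        · nlinarith
        · omega

lemma pell_le_succ (k : ℕ) : pell k ≤ pell (k + 1) := by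
  cases k with
  | zero => decide
  | succ k => simp only [pell]; omega

/-- Multiples of `rotAngle` up to `pell (k + 1)` stay away from the integers. -/
lemma no_short_return (k j : ℕ) (z : ℤ) (d : ℝ) (hj : 0 < j) (hj' : j < pell (k + 1))
    (hd : j * rotAngle = z + silverConj ^ k * d) (h1 : -1 + silverConj < d) (h2 : d < 1) :
    False := by
  have hb := silverConj_bounds
  have hdet := pell_det k
  obtain ⟨u, v, hu, hv⟩ : ∃ u v : ℤ, (j : ℤ) = u * pell k + v * pell (k + 1) ∧
      z = u * pellShift k + v * pellShift (k + 1) := by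
    set D : ℤ := pell k * pellShift (k + 1) - pell (k + 1) * pellShift k with hD
    refine ⟨D * (j * pellShift (k + 1) - z * pell (k + 1)),
      D * (z * pell k - j * pellShift k), ?_, ?_⟩
    · linear_combination (-(j : ℤ)) * hdet + (D * j) * hD
    · linear_combination (-z) * hdet + (D * z) * hD
  have e : d = u + v * silverConj := by
    have hpow : silverConj ^ k ≠ 0 := pow_ne_zero _ silverConj_ne_zero
    apply mul_left_cancel₀ hpow
    have hu' : (j : ℝ) = u * pell k + v * pell (k + 1) := by exact_mod_cast hu
    have hv' : (z : ℝ) = u * pellShift k + v * pellShift (k + 1) := by exact_mod_cast hv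
    have a1 := pell_mul_rotAngle k
    have a2 := pell_mul_rotAngle (k + 1)
    rw [pow_succ] at a2
    rw [hu', hv'] at hd
    linear_combination (-1) * hd + u * a1 + v * a2
  have hpos : (0 : ℤ) < pell (k + 1) := by exact_mod_cast pell_pos k
  have hnn : (0 : ℤ) ≤ pell k := by positivity
  have hjz : (0 : ℤ) < j := by exact_mod_cast hj
  have hjz' : (j : ℤ) < pell (k + 1) := by exact_mod_cast hj'
  rcases lt_trichotomy v 0 with hv0 | hv0 | hv0
  · have hu1 : 1 ≤ u := by
      by_contra hc
      have : u ≤ 0 := by omega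
      nlinarith
    have : (1 : ℝ) ≤ u := by exact_mod_cast hu1
    have : (v : ℝ) ≤ 0 := by exact_mod_cast hv0.le
    nlinarith
  · subst hv0
    have hu1 : 1 ≤ u := by
      by_contra hc
      have : u ≤ 0 := by omega
      nlinarith
    have : (1 : ℝ) ≤ u := by exact_mod_cast hu1
    simp at e
    linarith
  · have hu1 : u ≤ -1 := by
      by_contra hc
      have : 0 ≤ u := by omega
      nlinarith
    have : (u : ℝ) ≤ -1 := by exact_mod_cast hu1
    have : (1 : ℝ) ≤ v := by exact_mod_cast hv0
    nlinarith

/-- The points of the orbit of `rotAngle / 2` are not integers. -/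
lemma orbit_ne_int (n : ℕ) (z : ℤ) : rotAngle / 2 + n * rotAngle ≠ z := by
  intro h
  unfold rotAngle at h
  have hn : ((2 * n + 1 : ℕ) : ℝ) ≠ 0 := by positivity
  have : √2 = ((2 * (2 * n + 1) - 2 * z : ℤ) : ℝ) / ((2 * n + 1 : ℕ) : ℝ) := by
    rw [eq_div_iff hn]
    push_cast
    linarith
  refine irrational_sqrt_two.ne_rat ((2 * (2 * n + 1) - 2 * z : ℤ) / (2 * n + 1 : ℕ) : ℚ) ?_
  rw [this]
  push_cast
  rfl

lemma floorBit_eq_of_not_separated {x y : ℝ}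
    (hx : ∀ z : ℤ, x ≠ z) (hy : ∀ z : ℤ, y ≠ z)
    (h : ∀ z : ℤ, ¬ (x - z) * (y - z) < 0) : floorBit x = floorBit y := by
  have aux : ∀ a b : ℝ, (∀ z : ℤ, b ≠ z) → (∀ z : ℤ, ¬ (a - z) * (b - z) < 0) → ¬ ⌊a⌋ < ⌊b⌋ := by
    intro a b hb h hlt
    have h1 : a < ⌊b⌋ := Int.floor_lt.1 hlt
    have h2 : (⌊b⌋ : ℝ) < b := lt_of_le_of_ne (Int.floor_le b) (hb _).symm
    exact h ⌊b⌋ (mul_neg_of_neg_of_pos (by linarith) (by linarith))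
  have : ⌊x⌋ = ⌊y⌋ := le_antisymm (not_lt.1 (aux y x hx fun z => by rw [mul_comm]; exact h z))
    (not_lt.1 (aux x y hy h))
  simp [floorBit, this]

lemma floorBit_ne_of_separated {x y : ℝ} (hxy : |x - y| < 1) (z : ℤ)
    (h : (x - z) * (y - z) < 0) : floorBit x ≠ floorBit y := by
  have aux : ∀ a b : ℝ, |a - b| < 1 → a < z → z < b → floorBit a ≠ floorBit b := by
    intro a b hab ha hb
    have h1 := abs_lt.1 hab
    have e1 : ⌊a⌋ = z - 1 := Int.floor_eq_iff.2 ⟨by push_cast; linarith, by push_cast; linarith⟩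
    have e2 : ⌊b⌋ = z := Int.floor_eq_iff.2 ⟨by linarith, by linarith⟩
    simp only [floorBit, e1, e2, Int.even_sub_one]
    by_cases hz : Even z <;> simp [hz]
  rcases mul_neg_iff.1 h with ⟨h1, h2⟩ | ⟨h1, h2⟩
  · exact (aux y x (by rwa [abs_sub_comm]) (by linarith) (by linarith)).symm
  · exact aux x y hxy (by linarith) (by linarith)

/-- The `n`-th point of the orbit coded by the word `r`. -/
noncomputable def orbitPoint (n : ℕ) : ℝ := rotAngle / 2 + n * rotAngle

lemma orbitPoint_add_period (m n : ℕ) : ∃ z : ℤ, orbitPoint (n + (pell (m + 1) + pell m)) =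
    orbitPoint n + silverConj ^ (m + 1) * (silverConj - 1) + 2 * z := by
  obtain ⟨z, hz⟩ := (pellShift_odd (m + 1)).add_odd (pellShift_odd m)
  refine ⟨z, ?_⟩
  have hz' : (pellShift (m + 1) + pellShift m : ℝ) = z + z := by exact_mod_cast hz
  have a1 := pell_mul_rotAngle m
  have a2 := pell_mul_rotAngle (m + 1)
  rw [pow_succ] at a2
  unfold orbitPoint
  push_cast
  rw [pow_succ]
  linear_combination a1 + a2 + hz' - silverConj ^ m * silverConj_sq

lemma floorBit_add_period (m n : ℕ) : floorBit (orbitPoint (n + (pell (m + 1) + pell m))) =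
    floorBit (orbitPoint n + silverConj ^ (m + 1) * (silverConj - 1)) := by
  obtain ⟨z, hz⟩ := orbitPoint_add_period m n
  rw [hz, floorBit_add_two_mul]

lemma orbitPoint_add_ne_int (m n : ℕ) (z : ℤ) :
    orbitPoint n + silverConj ^ (m + 1) * (silverConj - 1) ≠ z := by
  obtain ⟨y, hy⟩ := orbitPoint_add_period m n
  intro h
  rw [h] at hy
  refine orbit_ne_int (n + (pell (m + 1) + pell m)) (z + 2 * y) ?_
  push_cast
  rw [← hy, orbitPoint]
  push_cast
  rfl

lemma exists_mismatch (m i : ℕ) : ∃ j < pell (m + 2),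
    floorBit (orbitPoint (i + j)) ≠ floorBit (orbitPoint (i + j + (pell (m + 1) + pell m))) := by
  have hb := silverConj_bounds
  obtain ⟨n, z, t, hy, ht⟩ := exists_tower (m + 1)
    (orbitPoint (i + (pell (m + 2) - 1)) - silverConj ^ (m + 1))
  have hle : pell (m + 1) ≤ pell (m + 2) := pell_le_succ (m + 1)
  have hn : n < pell (m + 2) := by
    rcases ht with ⟨-, -, h⟩ | ⟨-, -, h⟩
    · exact h.trans_le hle
    · exact h
  have h1 : -1 ≤ t := by rcases ht with h | h <;> linarith
  have h2 : t ≤ -silverConj := by rcases ht with h | h <;> linarith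
  refine ⟨pell (m + 2) - 1 - n, by omega, ?_⟩
  set q := i + (pell (m + 2) - 1 - n) with hq
  have hx : orbitPoint q = z + silverConj ^ (m + 1) * (t + 1) := by
    have : i + (pell (m + 2) - 1) = q + n := by omega
    rw [this] at hy
    unfold orbitPoint at hy ⊢
    push_cast at hy
    linarith
  rw [floorBit_add_period]
  refine floorBit_ne_of_separated ?_ z ?_
  · have hp : |silverConj ^ (m + 1)| ≤ |silverConj| := by
      rw [abs_pow, pow_succ]
      have : |silverConj| ≤ 1 := abs_le.2 ⟨by linarith, by linarith⟩
      exact mul_le_of_le_one_left (abs_nonneg _) (pow_le_one₀ (abs_nonneg _) this)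
    rw [sub_add_cancel_left, abs_neg, abs_mul]
    rw [abs_of_neg (show silverConj < 0 by linarith)] at hp
    rw [abs_of_neg (show silverConj - 1 < 0 by linarith)]
    nlinarith [abs_nonneg (silverConj ^ (m + 1))]
  · have hpow : silverConj ^ (m + 1) ≠ 0 := pow_ne_zero _ silverConj_ne_zero
    have ht1 : t + 1 ≠ 0 := by
      intro h
      rw [h, mul_zero, add_zero] at hx
      exact orbit_ne_int _ _ hx
    have ht2 : t + silverConj ≠ 0 := by
      intro h
      refine orbitPoint_add_ne_int m q z ?_
      rw [hx]
      linear_combination silverConj ^ (m + 1) * h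
    have e : (orbitPoint q - z) *
        (orbitPoint q + silverConj ^ (m + 1) * (silverConj - 1) - z) =
        (silverConj ^ (m + 1)) ^ 2 * ((t + 1) * (t + silverConj)) := by
      rw [hx]; ring
    rw [e]
    refine mul_neg_of_pos_of_neg (by positivity) (mul_neg_of_pos_of_neg ?_ ?_)
    · exact lt_of_le_of_ne (by linarith) ht1.symm
    · exact lt_of_le_of_ne (by linarith) ht2

lemma exists_matching_window (m : ℕ) : ∃ h : ℕ, ∀ j, 0 < j → j < pell (m + 2) →
    floorBit (orbitPoint (h + j)) = floorBit (orbitPoint (h + j + (pell (m + 1) + pell m))) := by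
  have hb := silverConj_bounds
  have hq := silverConj_sq
  obtain ⟨h0, hh⟩ := pell_add_odd m
  obtain ⟨z0, hz0⟩ := (pellShift_odd (m + 1)).add_odd (pellShift_odd m)
  refine ⟨h0 + 2 * pell (m + 1), fun j hj hj' => ?_⟩
  rw [floorBit_add_period]
  refine floorBit_eq_of_not_separated (fun z => orbit_ne_int _ z)
    (fun z => orbitPoint_add_ne_int _ _ z) fun z hz => ?_
  have hpow : silverConj ^ (m + 1) ≠ 0 := pow_ne_zero _ silverConj_ne_zero
  obtain ⟨t, ht⟩ : ∃ t, orbitPoint (h0 + 2 * pell (m + 1) + j) =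
      z + silverConj ^ (m + 1) * t :=
    ⟨(orbitPoint (h0 + 2 * pell (m + 1) + j) - z) / silverConj ^ (m + 1), by
      rw [mul_div_cancel₀ _ hpow]; ring⟩
  have e : (z + silverConj ^ (m + 1) * t - z) *
      (z + silverConj ^ (m + 1) * t + silverConj ^ (m + 1) * (silverConj - 1) - z) =
      (silverConj ^ (m + 1)) ^ 2 * (t * (t + silverConj - 1)) := by ring
  rw [ht, e] at hz
  have hneg : t * (t + silverConj - 1) < 0 := by
    by_contra hc
    exact absurd hz (not_lt.2 (mul_nonneg (sq_nonneg _) (not_lt.1 hc)))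
  have ht0 : 0 < t := by
    by_contra hc
    nlinarith
  have ht1 : t < 1 - silverConj := by
    by_contra hc
    nlinarith
  refine no_short_return (m + 1) j (z - z0 - 2 * pellShift (m + 1))
    (t - (3 + silverConj) / 2) hj hj' ?_ (by linarith) (by linarith)
  have hh' : (pell (m + 1) + pell m : ℝ) = 2 * h0 + 1 := by exact_mod_cast hh
  have hz' : (pellShift (m + 1) + pellShift m : ℝ) = z0 + z0 := by exact_mod_cast hz0
  have a1 := pell_mul_rotAngle m
  have a2 := pell_mul_rotAngle (m + 1)
  unfold orbitPoint at ht
  push_cast at ht ⊢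
  rw [pow_succ] at ht a2 ⊢
  linear_combination ht - a1 / 2 - (5 / 2) * a2 + (rotAngle / 2) * hh' - hz' / 2
    + (silverConj ^ m / 2) * hq

lemma orbitCode_shift_infix {i L N : ℕ} (h : i + L ≤ N) :
    orbitCode (orbitPoint i) L <:+: orbitCode (rotAngle / 2) N := by
  obtain ⟨k, rfl⟩ := Nat.exists_eq_add_of_le h
  rw [orbitCode_append, orbitCode_append]
  exact ⟨_, _, rfl⟩

lemma exists_eq_orbitCode_of_infix {w : List (Fin 2)} {N : ℕ}
    (h : w <:+: orbitCode (rotAngle / 2) N) : ∃ i, w = orbitCode (orbitPoint i) w.length := by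
  obtain ⟨s, t, hst⟩ := h
  have hN : N = s.length + w.length + t.length := by
    have := congrArg List.length hst
    simp at this
    omega
  rw [hN, orbitCode_append, orbitCode_append] at hst
  have h1 := List.append_inj_left hst (by simp)
  exact ⟨s.length, List.append_inj_right h1 (by simp)⟩

lemma lt_length_tauPhi (n : ℕ) : n < (tauPhi n [0]).length := by
  have pos : ∀ n c, 0 < (tauPhi n [c]).length := by
    intro n
    induction n with
    | zero => decide
    | succ n ih =>
      intro c
      rw [tauPhi_succ]
      have : phim c = [0] ++ (phim c).tail := by fin_cases c <;> rfl
      rw [this, tauPhi_append, List.length_append]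
      have := ih 0
      omega
  induction n with
  | zero => decide
  | succ n ih =>
    have : tauPhi n (phim 0) = tauPhi n [0] ++ tauPhi n [1] := by
      rw [← tauPhi_append]; rfl
    rw [tauPhi_succ, this, List.length_append]
    have := pos n 1
    omega

lemma orbitCode_orbitPoint_getElem? {i L j : ℕ} (h : j < L) :
    (orbitCode (orbitPoint i) L)[j]? = some (floorBit (orbitPoint (i + j))) := by
  rw [orbitCode_getElem? _ _ _ h]
  unfold orbitPoint
  push_cast
  ring_nf

theorem stmt11 (m : ℕ) (hm : 3 ≤ m) :
    (∃ (n : ℕ) (w : List (Fin 2)),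
        w <:+: applyM taum (phipow n [0]) ∧
        w.length = pell (m+2) + pell (m+1) + pell m - 1 ∧
        IsPeriod w (pell (m+1) + pell m)) ∧
    ¬ (∃ (n : ℕ) (w : List (Fin 2)),
        w <:+: applyM taum (phipow n [0]) ∧
        w.length = pell (m+2) + pell (m+1) + pell m ∧
        IsPeriod w (pell (m+1) + pell m)) := by
  have hpos := pell_pos m
  have hpos' : 0 < pell (m + 2) := pell_pos (m + 1)
  constructor
  · obtain ⟨h, hmatch⟩ := exists_matching_window m
    set L := pell (m+2) + pell (m+1) + pell m - 1 with hL
    refine ⟨h + 1 + L, orbitCode (orbitPoint (h + 1)) L, ?_, by simp, by omega, ?_, ?_⟩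
    · change _ <:+: tauPhi (h + 1 + L) [0]
      rw [tauPhi_eq_orbitCode]
      exact orbitCode_shift_infix (lt_length_tauPhi _).le
    · simp; omega
    · intro i hi
      rw [orbitCode_length] at hi
      rw [orbitCode_orbitPoint_getElem? (by omega), orbitCode_orbitPoint_getElem? hi]
      have := hmatch (i + 1) (by omega) (by omega)
      convert congrArg some this using 4 <;> ring
  · rintro ⟨n, w, hw, hlen, -, -, hper⟩
    change w <:+: tauPhi n [0] at hw
    rw [tauPhi_eq_orbitCode] at hw
    obtain ⟨i, hi⟩ := exists_eq_orbitCode_of_infix hw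
    obtain ⟨j, hj, hne⟩ := exists_mismatch m i
    have := hper j (by omega)
    rw [hi, orbitCode_orbitPoint_getElem? (by omega), orbitCode_orbitPoint_getElem? (by omega)]
      at this
    exact hne (by simpa [add_assoc] using this)
end

section
/- Every infinite rich word over a finite alphabet contains a square, i.e., a nonempty factor of the form u·u. -/
/-- A finite word is rich if its number of distinct nonempty palindromic factors
equals its length. -/
def Rich {α : Type*} (w : List α) : Prop :=
  {u : List α | u ≠ [] ∧ u <:+: w ∧ u.reverse = u}.ncard = w.length

/-- `u` is a (finite) factor of the infinite word `x : ℕ → α`. -/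
def FactorOfInf {α : Type*} (u : List α) (x : ℕ → α) : Prop :=
  ∃ i : ℕ, u = (List.range u.length).map (fun k => x (i + k))

/-- `x[p..q]` (both ends included) is a palindrome. -/
def PalOn {α : Type*} (x : ℕ → α) (p q : ℕ) : Prop :=
  ∀ k l, p ≤ k → p ≤ l → k + l = p + q → x k = x l

/-- Every complete return to a nonempty palindrome is a palindrome. -/
def PalReturns {α : Type*} (x : ℕ → α) : Prop :=
  ∀ i m L, PalOn x i (i + L) → i < m → (∀ t ≤ L, x (m + t) = x (i + t)) →
    (∀ k, i < k → k < m → ¬ ∀ t ≤ L, x (k + t) = x (i + t)) → PalOn x i (m + L)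

/-- The infinite word `x` contains no square. -/
def SqFree {α : Type*} (x : ℕ → α) : Prop :=
  ∀ i m, 0 < m → ∃ t < m, x (i + t) ≠ x (i + m + t)

/-- The factor of `x` of length `n` starting at position `i`. -/
def seg {α : Type*} (x : ℕ → α) (i n : ℕ) : List α :=
  (List.range n).map fun k => x (i + k)

section Segments

variable {α : Type*} {x : ℕ → α}

@[simp] theorem length_seg (i n : ℕ) : (seg x i n).length = n := by simp [seg]

theorem seg_add (i m n : ℕ) : seg x i (m + n) = seg x i m ++ seg x (i + m) n := by
  simp [seg, List.range_add, add_assoc]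

theorem factorOfInf_seg (i n : ℕ) : FactorOfInf (seg x i n) x :=
  ⟨i, by rw [length_seg]; rfl⟩

theorem seg_infix {i s l n : ℕ} (h : s + l ≤ n) : seg x (i + s) l <:+: seg x i n := by
  obtain ⟨d, rfl⟩ := Nat.exists_eq_add_of_le h
  rw [seg_add, seg_add]
  exact ⟨_, _, rfl⟩

theorem exists_seg_of_infix {u : List α} {i n : ℕ} (h : u <:+: seg x i n) :
    ∃ s, s + u.length ≤ n ∧ u = seg x (i + s) u.length := by
  obtain ⟨a, b, hab⟩ := h
  have hlen : a.length + u.length + b.length = n := by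
    simpa [add_assoc] using congrArg List.length hab
  refine ⟨a.length, by omega, ?_⟩
  rw [← hlen, seg_add, seg_add] at hab
  exact (List.append_inj (List.append_inj hab (by simp)).1 (by simp)).2

theorem seg_congr {i j n : ℕ} (h : ∀ t < n, x (i + t) = x (j + t)) : seg x i n = seg x j n :=
  List.map_congr_left fun t ht => h t (List.mem_range.1 ht)

theorem palOn_of_reverse_seg {i n : ℕ} (h : (seg x i (n + 1)).reverse = seg x i (n + 1)) :
    PalOn x i (i + n) := by
  intro k l hk hl hkl
  obtain ⟨s, rfl⟩ := Nat.exists_eq_add_of_le hk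
  obtain ⟨t, rfl⟩ := Nat.exists_eq_add_of_le hl
  have hs : s < n + 1 := by omega
  have h1 := congrArg (fun w : List α => w[s]?) h
  have h2 : n - s = t := by omega
  simpa [seg, List.getElem?_reverse, hs, h2, show t < n + 1 by omega, eq_comm] using h1

end Segments

section Richness

variable {α : Type*} {x : ℕ → α}

theorem exists_unioccurrent_palindromic_suffix (hrich : ∀ u : List α, FactorOfInf u x → Rich u)
    (i n : ℕ) : ∃ s ≤ n, PalOn x (i + s) (i + n) ∧
      ∀ s' < s, ¬ ∀ t, s + t ≤ n → x (i + s' + t) = x (i + s + t) := by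
  have h1 := hrich _ (factorOfInf_seg (x := x) i (n + 1))
  have h0 := hrich _ (factorOfInf_seg (x := x) i n)
  unfold Rich at h0 h1
  rw [length_seg] at h0 h1
  have hsub : seg x i n <:+: seg x i (n + 1) := by
    simpa using seg_infix (x := x) (i := i) (s := 0) (l := n) (n := n + 1) (by omega)
  have hfin := Set.finite_of_ncard_ne_zero (by rw [h1]; omega)
  have hlt : {u : List α | u ≠ [] ∧ u <:+: seg x i n ∧ u.reverse = u}.ncard <
      {u : List α | u ≠ [] ∧ u <:+: seg x i (n + 1) ∧ u.reverse = u}.ncard := by omega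
  obtain ⟨u, ⟨hne, hu, hpal⟩, hnot⟩ := Set.exists_mem_notMem_of_ncard_lt_ncard hlt
    (hfin.subset fun u hu => ⟨hu.1, hu.2.1.trans hsub, hu.2.2⟩)
  have hnew : ¬ u <:+: seg x i n := fun h => hnot ⟨hne, h, hpal⟩
  obtain ⟨s, hs, hseg⟩ := exists_seg_of_infix hu
  have hpos := List.length_pos_of_ne_nil hne
  generalize u.length = l at hs hseg hpos
  subst hseg
  have hl : s + l = n + 1 := by
    by_contra hcon
    exact hnew (seg_infix (by omega))
  obtain ⟨m, rfl⟩ : ∃ m, l = m + 1 := ⟨l - 1, by omega⟩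
  obtain rfl : n = s + m := by omega
  refine ⟨s, by omega, ?_, fun s' hs' hcon => hnew ?_⟩
  · rw [← add_assoc]
    exact palOn_of_reverse_seg hpal
  · rw [← seg_congr (i := i + s') fun t ht => hcon t (by omega)]
    exact seg_infix (by omega)

theorem palReturns_of_rich (hrich : ∀ u : List α, FactorOfInf u x → Rich u) : PalReturns x := by
  intro i m L hpal him hocc hret
  obtain ⟨d, rfl⟩ := Nat.exists_eq_add_of_lt him
  obtain ⟨s, hs, hP, huni⟩ := exists_unioccurrent_palindromic_suffix hrich i (d + 1 + L)
  have hP' : ∀ k l, i + s ≤ k → i + s ≤ l → k + l = i + s + (i + (d + 1 + L)) → x k = x l := hP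
  rcases Nat.lt_or_ge d s with hds | hds
  · refine absurd ?_ (huni (s - (d + 1)) (by omega))
    intro t ht
    have := hocc (s - (d + 1) + t) (by omega)
    rw [show i + s + t = i + d + 1 + (s - (d + 1) + t) by omega, this]
    congr 1
    omega
  · rcases Nat.eq_zero_or_pos s with rfl | hpos
    · have := hP
      rwa [Nat.add_zero, show i + (d + 1 + L) = i + d + 1 + L by omega] at this
    · refine absurd ?_ (hret (i + s) (by omega) (by omega))
      intro t ht
      rw [hP' (i + s + t) (i + d + 1 + (L - t)) (by omega) (by omega) (by omega),
        hocc _ (by omega)]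
      exact hpal _ _ (by omega) (by omega) (by omega)

end Richness

section Traversals

variable {α : Type*} {x : ℕ → α} {a c : α}

theorem PalReturns.palOn_letter (hx : PalReturns x) {i m : ℕ} (him : i < m) (h : x m = x i)
    (hret : ∀ k, i < k → k < m → x k ≠ x i) : PalOn x i m := by
  refine hx i m 0 ?_ him ?_ ?_
  · intro k l hk hl hkl
    congr 1
    omega
  · intro t ht
    obtain rfl : t = 0 := by omega
    exact h
  · intro k hk hkm hcon
    exact hret k hk hkm (hcon 0 le_rfl)

/-- `x[p..q]` starts with `c`, ends with `a`, and contains no other occurrence of either letter. -/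
structure Traversal (x : ℕ → α) (c a : α) (p q : ℕ) : Prop where
  lt : p < q
  left : x p = c
  right : x q = a
  ne_left : ∀ k, p < k → k < q → x k ≠ c
  ne_right : ∀ k, p < k → k < q → x k ≠ a

theorem Traversal.exists_reversed (hx : PalReturns x) (hca : c ≠ a) {p q N : ℕ}
    (h : Traversal x c a p q) (hN : q ≤ N) (hxN : x N = c) :
    ∃ r s, q ≤ r ∧ s ≤ N ∧ Traversal x a c r s ∧ s + p = r + q ∧
      ∀ k l, p ≤ k → k ≤ q → k + l = p + s → x k = x l := by
  classical
  have hex : ∃ s, p < s ∧ x s = c := ⟨N, lt_of_lt_of_le h.lt hN, hxN⟩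
  obtain ⟨s, ⟨hps, hs⟩, hmin⟩ : ∃ s, (p < s ∧ x s = c) ∧ ∀ k, p < k → k < s → x k ≠ c :=
    ⟨Nat.find hex, Nat.find_spec hex, fun k hk hks hc => Nat.find_min hex hks ⟨hk, hc⟩⟩
  have hsN : s ≤ N := by
    by_contra hcon
    exact hmin N (lt_of_lt_of_le h.lt hN) (by omega) hxN
  have hpq := h.lt
  have hqs : q < s := by
    by_contra hcon
    rcases (not_lt.1 hcon).lt_or_eq with hlt | rfl
    · exact h.ne_left s hps hlt hs
    · exact hca (hs.symm.trans h.right)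
  have hpal : PalOn x p s := hx.palOn_letter hps (hs.trans h.left.symm)
    fun k hk hks => by rw [h.left]; exact hmin k hk hks
  obtain ⟨r, hr⟩ : ∃ r, s + p = r + q := ⟨s + p - q, by omega⟩
  have hxr : x r = a := (hpal r q (by omega) (by omega) (by omega)).trans h.right
  have hqr : q ≤ r := by
    by_contra hcon
    exact h.ne_right r (by omega) (by omega) hxr
  refine ⟨r, s, hqr, hsN, ⟨by omega, hxr, hs, ?_, ?_⟩, hr, fun k l hk hkq hkl =>
    hpal k l hk (by omega) hkl⟩
  · intro k hk hks
    rw [hpal k (p + s - k) (by omega) (by omega) (by omega)]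
    exact h.ne_right _ (by omega) (by omega)
  · intro k hk hks
    exact hmin k (by omega) hks

theorem Traversal.unique_of_lt (hx : PalReturns x) (hca : c ≠ a) {p p' q q' : ℕ}
    (h : Traversal x c a p p') (h' : Traversal x c a q q') (hpq : p < q) :
    p' + q = q' + p ∧ ∀ t, p + t ≤ p' → x (p + t) = x (q + t) := by
  induction hn : q - p using Nat.strong_induction_on generalizing p p' with
  | _ n ih =>
    have hlt := h.lt
    have hlt' := h'.lt
    have hp'q : p' ≤ q := by
      by_contra hcon
      exact h.ne_left q hpq (by omega) h'.left
    obtain ⟨r, r', hr, hr', hT, hlen, hrefl⟩ := h.exists_reversed hx hca hp'q h'.left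
    obtain ⟨s, s', hs, hs', hT', hlen', hrefl'⟩ :=
      hT.exists_reversed hx hca.symm (N := q') (by omega) h'.right
    have hss' := hT'.lt
    have hrr' := hT.lt
    have hkey : ∀ t, p + t ≤ p' → x (p + t) = x (s + t) := by
      intro t ht
      rw [hrefl (p + t) (r' - t) (by omega) (by omega) (by omega)]
      exact hrefl' _ _ (by omega) (by omega) (by omega)
    have hsq : s ≤ q := by
      by_contra hcon
      exact h'.ne_left s (by omega) (by omega) hT'.left
    rcases hsq.lt_or_eq with hsq | rfl
    · obtain ⟨h1, h2⟩ := ih (q - s) (by omega) hT' hsq rfl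
      exact ⟨by omega, fun t ht => (hkey t ht).trans (h2 t (by omega))⟩
    · have : s' = q' := by
        by_contra hcon
        exact h'.ne_right s' hss' (by omega) hT'.right
      exact ⟨by omega, hkey⟩

theorem Traversal.unique (hx : PalReturns x) (hca : c ≠ a) {p p' q q' : ℕ}
    (h : Traversal x c a p p') (h' : Traversal x c a q q') :
    p' + q = q' + p ∧ ∀ t, p + t ≤ p' → x (p + t) = x (q + t) := by
  have hlt := h.lt
  have hlt' := h'.lt
  rcases lt_trichotomy p q with hpq | rfl | hpq
  · exact h.unique_of_lt hx hca h' hpq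
  · refine ⟨?_, fun t _ => rfl⟩
    have h1 : ¬ p' < q' := fun hcon => h'.ne_right p' hlt hcon h.right
    have h2 : ¬ q' < p' := fun hcon => h.ne_right q' hlt' hcon h'.right
    omega
  · obtain ⟨h1, h2⟩ := h'.unique_of_lt hx hca h hpq
    exact ⟨h1.symm, fun t ht => (h2 t (by omega)).symm⟩

end Traversals

/-- `f` enumerates increasingly the occurrences of the letter `a` in `x`. -/
structure Enumerates {α : Type*} (f : ℕ → ℕ) (x : ℕ → α) (a : α) : Prop where
  mono : StrictMono f
  iff : ∀ k, x k = a ↔ ∃ n, f n = k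

/-- The word of the central letters of the blocks of `x` cut at the positions `f n`. -/
def centers {α : Type*} (x : ℕ → α) (f : ℕ → ℕ) (n : ℕ) : α :=
  x ((f n + f (n + 1)) / 2)

theorem exists_enumerates {α : Type*} {x : ℕ → α} {a : α} (h : {k | x k = a}.Infinite) :
    ∃ f, Enumerates f x a := by
  classical
  refine ⟨Nat.nth fun k => x k = a, Nat.nth_strictMono h, fun k => ⟨fun hk => ?_, ?_⟩⟩
  · exact ⟨_, Nat.nth_count (p := fun k => x k = a) hk⟩
  · rintro ⟨n, rfl⟩
    exact Nat.nth_mem_of_infinite h n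

namespace Enumerates

variable {α : Type*} {x : ℕ → α} {a : α} {f : ℕ → ℕ}

theorem apply_eq (hf : Enumerates f x a) (n : ℕ) : x (f n) = a := (hf.iff _).2 ⟨n, rfl⟩

theorem lt_succ (hf : Enumerates f x a) (n : ℕ) : f n < f (n + 1) := hf.mono (Nat.lt_succ_self n)

theorem succ_le (hf : Enumerates f x a) {n k : ℕ} (hk : x k = a) (h : f n < k) :
    f (n + 1) ≤ k := by
  obtain ⟨m, rfl⟩ := (hf.iff k).1 hk
  exact hf.mono.monotone (hf.mono.lt_iff_lt.1 h)

theorem palOn_block (hf : Enumerates f x a) (hx : PalReturns x) (n : ℕ) :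
    PalOn x (f n) (f (n + 1)) := by
  refine hx.palOn_letter (hf.lt_succ n) ((hf.apply_eq _).trans (hf.apply_eq _).symm) ?_
  intro k hk hk' hcon
  have := hf.succ_le (hcon.trans (hf.apply_eq n)) hk
  omega

theorem exists_mid (hf : Enumerates f x a) (hx : PalReturns x) (hsq : SqFree x) (n : ℕ) :
    ∃ m, 2 * m = f n + f (n + 1) ∧ centers x f n = x m := by
  refine ⟨(f n + f (n + 1)) / 2, ?_, rfl⟩
  by_contra hcon
  have hlt := hf.lt_succ n
  obtain ⟨t, ht, hne⟩ := hsq ((f n + f (n + 1)) / 2) 1 one_pos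
  obtain rfl : t = 0 := by omega
  exact hne (hf.palOn_block hx n _ _ (by omega) (by omega) (by omega))

theorem traversal_mid (hf : Enumerates f x a) (hx : PalReturns x) (hsq : SqFree x) {n m : ℕ}
    (hm : 2 * m = f n + f (n + 1)) : Traversal x (x m) a m (f (n + 1)) := by
  classical
  have hlt := hf.lt_succ n
  refine ⟨by omega, rfl, hf.apply_eq _, ?_, ?_⟩
  · intro k hk hkf hcon
    have hex : ∃ s, m < s ∧ x s = x m := ⟨k, hk, hcon⟩
    obtain ⟨s, ⟨hms, hs⟩, hsk, hmin⟩ :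
        ∃ s, (m < s ∧ x s = x m) ∧ s ≤ k ∧ ∀ j, m < j → j < s → x j ≠ x m :=
      ⟨Nat.find hex, Nat.find_spec hex, Nat.find_min' hex ⟨hk, hcon⟩,
        fun j hj hjs hc => Nat.find_min hex hjs ⟨hj, hc⟩⟩
    have hret : PalOn x m s := hx.palOn_letter hms hs hmin
    obtain ⟨t, ht, hne⟩ := hsq (m - (s - m)) (s - m) (by omega)
    refine hne ?_
    rw [hf.palOn_block hx n (m - (s - m) + t) (s - t) (by omega) (by omega) (by omega)]
    exact hret _ _ (by omega) (by omega) (by omega)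
  · intro k hk hkf hcon
    have := hf.succ_le (n := n) hcon (by omega)
    omega

theorem centers_ne (hf : Enumerates f x a) (hx : PalReturns x) (hsq : SqFree x) (n : ℕ) :
    centers x f n ≠ a := by
  obtain ⟨m, hm, hc⟩ := hf.exists_mid hx hsq n
  have hlt := hf.lt_succ n
  intro hcon
  have := hf.succ_le (n := n) (hc.symm.trans hcon) (by omega)
  omega

theorem block_eq (hf : Enumerates f x a) (hx : PalReturns x) (hsq : SqFree x) {i j : ℕ}
    (h : centers x f i = centers x f j) :
    f (i + 1) + f j = f (j + 1) + f i ∧ ∀ s, f i + s ≤ f (i + 1) → x (f i + s) = x (f j + s) := by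
  obtain ⟨m, hm, hc⟩ := hf.exists_mid hx hsq i
  obtain ⟨m', hm', hc'⟩ := hf.exists_mid hx hsq j
  have hT := hf.traversal_mid hx hsq hm
  have hT' := hf.traversal_mid hx hsq hm'
  rw [← hc', ← h, hc] at hT'
  obtain ⟨h1, h2⟩ := hT.unique hx (by rw [← hc]; exact hf.centers_ne hx hsq i) hT'
  refine ⟨by omega, fun s hs => ?_⟩
  have hlt := hf.lt_succ i
  rcases le_total m (f i + s) with hle | hle
  · have := h2 (f i + s - m) (by omega)
    convert this using 2 <;> omega
  · rw [hf.palOn_block hx i (f i + s) (f (i + 1) - s) (by omega) (by omega) (by omega),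
      hf.palOn_block hx j (f j + s) (f (j + 1) - s) (by omega) (by omega) (by omega)]
    have := h2 (f (i + 1) - s - m) (by omega)
    convert this using 2 <;> omega

theorem factor_eq (hf : Enumerates f x a) (hx : PalReturns x) (hsq : SqFree x) {i j l : ℕ}
    (h : ∀ t < l, centers x f (i + t) = centers x f (j + t)) :
    f (i + l) + f j = f (j + l) + f i ∧
      ∀ s, f i + s ≤ f (i + l) → x (f i + s) = x (f j + s) := by
  induction l with
  | zero =>
    refine ⟨add_comm _ _, fun s hs => ?_⟩
    obtain rfl : s = 0 := by simpa using hs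
    exact (hf.apply_eq i).trans (hf.apply_eq j).symm
  | succ l ih =>
    obtain ⟨h1, h2⟩ := ih fun t ht => h t (by omega)
    obtain ⟨h3, h4⟩ := hf.block_eq hx hsq (h l (by omega))
    have hi : f i ≤ f (i + l) := hf.mono.monotone (by omega)
    simp only [← add_assoc]
    refine ⟨by omega, fun s hs => ?_⟩
    rcases le_total (f i + s) (f (i + l)) with hle | hle
    · exact h2 s hle
    · have := h4 (f i + s - f (i + l)) (by omega)
      convert this using 2 <;> omega

theorem centers_eq_of_factor_eq (hf : Enumerates f x a) (hx : PalReturns x) (hsq : SqFree x)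
    {i j l : ℕ} (h : ∀ s, f i + s ≤ f (i + l) → x (f j + s) = x (f i + s)) :
    ∀ t < l, centers x f (j + t) = centers x f (i + t) := by
  have hpos : ∀ t ≤ l, f (i + t) + f j = f (j + t) + f i := by
    intro t
    induction t with
    | zero => intro _; exact add_comm _ _
    | succ t ih =>
      intro ht
      have h0 := ih (by omega)
      have hi : f i ≤ f (i + t) := hf.mono.monotone (by omega)
      have hj : f j ≤ f (j + t) := hf.mono.monotone (by omega)
      have hil : f (i + t + 1) ≤ f (i + l) := hf.mono.monotone (by omega)
      have hi' := hf.lt_succ (i + t)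
      have hj' := hf.lt_succ (j + t)
      have h1 : f (j + t + 1) ≤ f j + (f (i + t + 1) - f i) := by
        refine hf.succ_le ?_ (by omega)
        rw [h _ (by omega), show f i + (f (i + t + 1) - f i) = f (i + t + 1) by omega]
        exact hf.apply_eq _
      have h2 : f (i + t + 1) ≤ f i + (f (j + t + 1) - f j) := by
        refine hf.succ_le ?_ (by omega)
        rw [← h _ (by omega), show f j + (f (j + t + 1) - f j) = f (j + t + 1) by omega]
        exact hf.apply_eq _
      simp only [← add_assoc]
      omega
  intro t ht
  obtain ⟨m, hm, hc⟩ := hf.exists_mid hx hsq (i + t)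
  obtain ⟨m', hm', hc'⟩ := hf.exists_mid hx hsq (j + t)
  have h0 := hpos t (by omega)
  have h1 := hpos (t + 1) (by omega)
  simp only [← add_assoc] at h1
  have hi : f i ≤ f (i + t) := hf.mono.monotone (by omega)
  have hil : f (i + t + 1) ≤ f (i + l) := hf.mono.monotone (by omega)
  have hlt := hf.lt_succ (i + t)
  have := h (m - f i) (by omega)
  rw [hc, hc']
  convert this using 2 <;> omega

theorem palOn_of_palOn_centers (hf : Enumerates f x a) (hx : PalReturns x) (hsq : SqFree x)
    {i L : ℕ} (h : PalOn (centers x f) i (i + L)) : PalOn x (f i) (f (i + L + 1)) := by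
  have hpos : ∀ t r, t + r = L + 1 → f (i + t) + f (i + r) = f i + f (i + L + 1) := by
    intro t
    induction t with
    | zero => rintro r hr; obtain rfl : r = L + 1 := by omega
              rfl
    | succ t ih =>
      intro r hr
      have h0 := ih (r + 1) (by omega)
      have h1 := (hf.block_eq hx hsq
        (h (i + t) (i + r) (by omega) (by omega) (by omega))).1
      simp only [← add_assoc] at h0 ⊢
      omega
  have hloc : ∀ n k, f i ≤ k → k ≤ f (i + n + 1) →
      ∃ t ≤ n, f (i + t) ≤ k ∧ k ≤ f (i + t + 1) := by
    intro n
    induction n with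
    | zero => exact fun k h1 h2 => ⟨0, le_rfl, h1, h2⟩
    | succ n ih =>
      intro k h1 h2
      rcases le_total k (f (i + n + 1)) with hle | hle
      · obtain ⟨t, ht, h3⟩ := ih k h1 hle
        exact ⟨t, by omega, h3⟩
      · exact ⟨n + 1, le_rfl, hle, h2⟩
  intro k l hk hl hkl
  obtain ⟨t, ht, h1, h2⟩ := hloc L k hk (by omega)
  obtain ⟨r, hr⟩ := Nat.exists_eq_add_of_le ht
  have hb := hf.block_eq hx hsq (h (i + t) (i + r) (by omega) (by omega) (by omega))
  have h3 := hb.2 (k - f (i + t)) (by omega)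
  have h4 := hpos t (r + 1) (by omega)
  have h5 := hpos (t + 1) r (by omega)
  simp only [← add_assoc] at h4 h5
  rw [show f (i + t) + (k - f (i + t)) = k by omega] at h3
  rw [h3]
  exact hf.palOn_block hx (i + r) _ _ (by omega) (by omega) (by omega)

theorem palOn_centers_of_palOn (hf : Enumerates f x a) (hx : PalReturns x) (hsq : SqFree x)
    {i L : ℕ} (h : PalOn x (f i) (f (i + L + 1))) : PalOn (centers x f) i (i + L) := by
  have hpos : ∀ t r, t + r = L + 1 → f (i + t) + f (i + r) = f i + f (i + L + 1) := by
    intro t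
    induction t with
    | zero => rintro r hr; obtain rfl : r = L + 1 := by omega
              rfl
    | succ t ih =>
      intro r hr
      have h0 := ih (r + 1) (by omega)
      have hi : f i ≤ f (i + t) := hf.mono.monotone (by omega)
      have hr0 : f i ≤ f (i + r) := hf.mono.monotone (by omega)
      have htL : f (i + t + 1) ≤ f (i + L + 1) := hf.mono.monotone (by omega)
      have hrL : f (i + r) ≤ f (i + L + 1) := hf.mono.monotone (by omega)
      have hi' := hf.lt_succ (i + t)
      have hr' := hf.lt_succ (i + r)
      simp only [← add_assoc] at h0 ⊢
      have h1 : f (i + t + 1) ≤ f i + f (i + L + 1) - f (i + r) := by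
        refine hf.succ_le ?_ (by omega)
        rw [h _ (f (i + r)) (by omega) (by omega) (by omega)]
        exact hf.apply_eq _
      have h2 : ¬ f (i + r) < f i + f (i + L + 1) - f (i + t + 1) := by
        intro hcon
        have := hf.succ_le (n := i + r) (k := f i + f (i + L + 1) - f (i + t + 1)) (by
          rw [h _ (f (i + t + 1)) (by omega) (by omega) (by omega)]
          exact hf.apply_eq _) hcon
        omega
      omega
  intro k l hk hl hkl
  obtain ⟨t, rfl⟩ := Nat.exists_eq_add_of_le hk
  obtain ⟨r, rfl⟩ := Nat.exists_eq_add_of_le hl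
  obtain ⟨m, hm, hc⟩ := hf.exists_mid hx hsq (i + t)
  obtain ⟨m', hm', hc'⟩ := hf.exists_mid hx hsq (i + r)
  have h4 := hpos t (r + 1) (by omega)
  have h5 := hpos (t + 1) r (by omega)
  simp only [← add_assoc] at h4 h5
  have hi : f i ≤ f (i + t) := hf.mono.monotone (by omega)
  have hr0 : f i ≤ f (i + r) := hf.mono.monotone (by omega)
  have hi' := hf.lt_succ (i + t)
  have hr' := hf.lt_succ (i + r)
  rw [hc, hc']
  exact h _ _ (by omega) (by omega) (by omega)

theorem sqFree_centers (hf : Enumerates f x a) (hx : PalReturns x) (hsq : SqFree x) :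
    SqFree (centers x f) := by
  intro i m hm
  by_contra! hcon
  obtain ⟨h1, h2⟩ := hf.factor_eq hx hsq hcon
  have hlt : f i < f (i + m) := hf.mono (by omega)
  obtain ⟨t, ht, hne⟩ := hsq (f i) (f (i + m) - f i) (by omega)
  refine hne ?_
  rw [h2 t (by omega), show f i + (f (i + m) - f i) = f (i + m) by omega]

theorem palReturns_centers (hf : Enumerates f x a) (hx : PalReturns x) (hsq : SqFree x) :
    PalReturns (centers x f) := by
  intro i m L hpal him hocc hret
  have hi : f i < f (i + L + 1) := hf.mono (by omega)
  obtain ⟨h1, h2⟩ := hf.factor_eq hx hsq (i := i) (j := m) (l := L + 1)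
    fun t ht => (hocc t (by omega)).symm
  simp only [← add_assoc] at h1 h2
  have key : PalOn x (f i) (f (i + (m - i + L) + 1)) := by
    have hP := hf.palOn_of_palOn_centers hx hsq hpal
    have := hx (f i) (f m) (f (i + L + 1) - f i)
      (by rwa [show f i + (f (i + L + 1) - f i) = f (i + L + 1) by omega]) (hf.mono him)
      (fun t ht => (h2 t (by omega)).symm) ?_
    · convert this using 1
      rw [show i + (m - i + L) + 1 = m + L + 1 by omega]
      omega
    · intro k hk hkm hcon
      obtain ⟨n, rfl⟩ := (hf.iff k).1 ((hcon 0 (by omega)).trans (hf.apply_eq i))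
      refine hret n (hf.mono.lt_iff_lt.1 hk) (hf.mono.lt_iff_lt.1 hkm) fun t ht => ?_
      exact hf.centers_eq_of_factor_eq hx hsq (l := L + 1)
        (fun s hs => hcon s (by simp only [← add_assoc] at hs; omega)) t (by omega)
  convert hf.palOn_centers_of_palOn hx hsq key using 1
  omega

end Enumerates

theorem not_sqFree_of_palReturns {α : Type*} (s : Finset α) (x : ℕ → α) (hs : ∀ n, x n ∈ s)
    (hx : PalReturns x) : ¬ SqFree x := by
  classical
  induction hn : s.card generalizing s x with
  | zero =>
    rw [Finset.card_eq_zero] at hn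
    simpa [hn] using hs 0
  | succ n ih =>
    intro hsq
    obtain ⟨⟨a, ha⟩, hinf⟩ := Finite.exists_infinite_fiber fun n => (⟨x n, hs n⟩ : s)
    have hinf' : {k | x k = a}.Infinite := by
      convert Set.infinite_coe_iff.1 hinf using 1
      ext k
      simp
    obtain ⟨f, hf⟩ := exists_enumerates hinf'
    refine ih (s.erase a) (centers x f)
      (fun n => Finset.mem_erase.2 ⟨hf.centers_ne hx hsq n, hs _⟩)
      (hf.palReturns_centers hx hsq) ?_ (hf.sqFree_centers hx hsq)
    rw [Finset.card_erase_of_mem ha, hn, Nat.add_sub_cancel]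

theorem stmt14 {α : Type*} [Fintype α] (x : ℕ → α)
    (hrich : ∀ u : List α, FactorOfInf u x → Rich u) :
    ∃ u : List α, u ≠ [] ∧ FactorOfInf (u ++ u) x := by
  have h := not_sqFree_of_palReturns Finset.univ x (fun _ => Finset.mem_univ _)
    (palReturns_of_rich hrich)
  unfold SqFree at h
  push Not at h
  obtain ⟨i, m, hm, hsq⟩ := h
  refine ⟨seg x i m, fun h0 => ?_, ?_⟩
  · have := congrArg List.length h0
    simp at this
    omega
  · have : seg x i m ++ seg x i m = seg x i (m + m) := by
      rw [seg_add, ← seg_congr hsq]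
    rw [this]
    exact factorOfInf_seg i (m + m)
end

section
/- A finite word w is rich if and only if every nonempty prefix p of w has a palindromic suffix that is unioccurrent in p, i.e., a suffix of p that is a palindrome and is not a factor of any proper prefix of p. -/
/-- The nonempty palindromic factors of a word. -/
def palFactors {α : Type*} (w : List α) : Set (List α) :=
  {u : List α | u ≠ [] ∧ u <:+: w ∧ u.reverse = u}

theorem palFactors_finite {α : Type*} (w : List α) : (palFactors w).Finite :=
  (List.finite_toSet w.sublists).subset fun u hu => by
    simpa using hu.2.1.sublist

theorem palFactors_nil {α : Type*} : palFactors ([] : List α) = ∅ := by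
  ext u
  simp +contextual [palFactors]

theorem palFactors_subset_concat {α : Type*} (w : List α) (a : α) :
    palFactors w ⊆ palFactors (w ++ [a]) := fun _ hu =>
  ⟨hu.1, hu.2.1.trans (List.prefix_append w [a]).isInfix, hu.2.2⟩

/-- A palindromic suffix of `w ++ [a]` that is strictly shorter than another one is a
factor of `w`. -/
theorem infix_of_palindromic_suffix_of_length_lt {α : Type*} {w s t : List α} {a : α}
    (hs : s <:+ w ++ [a]) (ht : t <:+ w ++ [a]) (hsr : s.reverse = s) (htr : t.reverse = t)
    (hlt : s.length < t.length) : s <:+: w := by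
  have hst : s <+: t := by
    rw [← List.reverse_suffix, hsr, htr]
    exact List.suffix_of_suffix_length_le hs ht hlt.le
  obtain ⟨x, hx⟩ := ht
  have hne : t ≠ [] := by rintro rfl; simp at hlt
  obtain ⟨t', b, rfl⟩ := List.eq_nil_or_concat t |>.resolve_left hne
  rw [List.concat_eq_append] at *
  rw [← List.append_assoc] at hx
  have hw := (List.append_inj' hx rfl).1
  have hst' : s <+: t' := by
    rcases List.prefix_concat_iff.1 hst with h | h
    · simp [h] at hlt
    · exact h
  exact hst'.isInfix.trans ⟨x, [], by simpa using hw⟩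

theorem eq_of_new_palindromic_suffix {α : Type*} {w s t : List α} {a : α}
    (hs : s <:+ w ++ [a]) (ht : t <:+ w ++ [a]) (hsr : s.reverse = s) (htr : t.reverse = t)
    (hsw : ¬ s <:+: w) (htw : ¬ t <:+: w) : s = t := by
  rcases lt_trichotomy s.length t.length with h | h | h
  · exact absurd (infix_of_palindromic_suffix_of_length_lt hs ht hsr htr h) hsw
  · exact (List.suffix_of_suffix_length_le hs ht h.le).eq_of_length h
  · exact absurd (infix_of_palindromic_suffix_of_length_lt ht hs htr hsr h) htw

theorem palFactors_concat_of_new {α : Type*} {w s : List α} {a : α}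
    (hs : s <:+ w ++ [a]) (hsr : s.reverse = s) (hsw : ¬ s <:+: w) :
    palFactors (w ++ [a]) = insert s (palFactors w) := by
  refine Set.Subset.antisymm (fun u hu => ?_) (Set.insert_subset ?_ (palFactors_subset_concat w a))
  · by_cases huw : u <:+: w
    · exact Or.inr ⟨hu.1, huw, hu.2.2⟩
    · have hus := (List.infix_concat_iff.1 hu.2.1).resolve_right huw
      exact Or.inl (eq_of_new_palindromic_suffix hus hs hu.2.2 hsr huw hsw)
  · refine ⟨?_, hs.isInfix, hsr⟩
    rintro rfl
    exact hsw (List.nil_infix)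

theorem palFactors_concat_of_not_new {α : Type*} {w : List α} {a : α}
    (h : ¬ ∃ s : List α, s <:+ w ++ [a] ∧ s.reverse = s ∧ ¬ s <:+: w) :
    palFactors (w ++ [a]) = palFactors w := by
  refine Set.Subset.antisymm (fun u hu => ?_) (palFactors_subset_concat w a)
  by_contra huw
  have huw' : ¬ u <:+: w := fun h' => huw ⟨hu.1, h', hu.2.2⟩
  exact h ⟨u, (List.infix_concat_iff.1 hu.2.1).resolve_right huw', hu.2.2, huw'⟩

theorem ncard_palFactors_concat_of_new {α : Type*} {w : List α} {a : α}
    (h : ∃ s : List α, s <:+ w ++ [a] ∧ s.reverse = s ∧ ¬ s <:+: w) :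
    (palFactors (w ++ [a])).ncard = (palFactors w).ncard + 1 := by
  obtain ⟨s, hs, hsr, hsw⟩ := h
  rw [palFactors_concat_of_new hs hsr hsw,
    Set.ncard_insert_of_notMem (fun h => hsw h.2.1) (palFactors_finite w)]

theorem ncard_palFactors_le_length {α : Type*} (w : List α) :
    (palFactors w).ncard ≤ w.length := by
  induction w using List.reverseRecOn with
  | nil => simp [palFactors_nil]
  | append_singleton w a ih =>
    by_cases h : ∃ s : List α, s <:+ w ++ [a] ∧ s.reverse = s ∧ ¬ s <:+: w
    · rw [ncard_palFactors_concat_of_new h]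
      simpa using ih
    · rw [palFactors_concat_of_not_new h]
      simp only [List.length_append, List.length_singleton]
      omega

theorem rich_concat_iff {α : Type*} (w : List α) (a : α) :
    Rich (w ++ [a]) ↔
      Rich w ∧ ∃ s : List α, s <:+ w ++ [a] ∧ s.reverse = s ∧ ¬ s <:+: w := by
  change (palFactors (w ++ [a])).ncard = (w ++ [a]).length ↔
    (palFactors w).ncard = w.length ∧ _
  have hle := ncard_palFactors_le_length w
  by_cases h : ∃ s : List α, s <:+ w ++ [a] ∧ s.reverse = s ∧ ¬ s <:+: w
  · rw [ncard_palFactors_concat_of_new h]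
    simp [h]
  · rw [palFactors_concat_of_not_new h]
    simp only [h, and_false, iff_false, List.length_append, List.length_singleton]
    omega

/-- Being a factor of no proper prefix of `w ++ [a]` means not being a factor of `w`. -/
theorem forall_proper_prefix_concat_iff {α : Type*} (w s : List α) (a : α) :
    (∀ q : List α, q <+: w ++ [a] → q ≠ w ++ [a] → ¬ (s <:+: q)) ↔ ¬ s <:+: w := by
  constructor
  · intro h
    exact h w (List.prefix_append w [a]) (by simp)
  · intro h q hq hne hsq
    exact h (hsq.trans ((List.prefix_concat_iff.1 hq).resolve_left hne).isInfix)

theorem stmt15 {α : Type*} (w : List α) :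
    Rich w ↔
      ∀ p : List α, p <+: w → p ≠ [] →
        ∃ s : List α, s <:+ p ∧ s.reverse = s ∧
          ∀ q : List α, q <+: p → q ≠ p → ¬ (s <:+: q) := by
  induction w using List.reverseRecOn with
  | nil =>
    refine iff_of_true ?_ fun p hp hne => absurd (List.prefix_nil.1 hp) hne
    change (palFactors ([] : List α)).ncard = 0
    simp [palFactors_nil]
  | append_singleton w a ih =>
    rw [rich_concat_iff, ih]
    simp only [← forall_proper_prefix_concat_iff w _ a]
    constructor
    · rintro ⟨h, hs⟩ p hp hne
      rcases List.prefix_concat_iff.1 hp with rfl | hp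
      · exact hs
      · exact h p hp hne
    · intro h
      exact ⟨fun p hp => h p (hp.trans (List.prefix_append w [a])),
        h _ (List.prefix_refl _) (by simp)⟩
end

section
/- There exists an infinite word over the binary alphabet {0,1} that is rich and whose critical exponent equals 2 + √2/2; in particular, every nonempty factor w of this word with period p satisfies |w|/p < 2 + √2/2, while factors of exponent arbitrarily close to 2 + √2/2 occur. -/
/-- The integer part of `m √2`. -/
noncomputable def floorMulSqrtTwo (m : ℤ) : ℤ := ⌊(m : ℝ) * √2⌋

/-- The binary word whose `n`-th letter is the parity of `⌊(n + 1) √2⌋`. -/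
noncomputable def parityWord (n : ℕ) : Fin 2 :=
  if Even (floorMulSqrtTwo (n + 1)) then 0 else 1

/-- Denominators of the convergents of `√2` (the Pell numbers) paired with their numerators. -/
def pellPair : ℕ → ℤ × ℤ
  | 0 => (0, 1)
  | n + 1 => ((pellPair n).1 + (pellPair n).2, 2 * (pellPair n).1 + (pellPair n).2)

local notation "g" => floorMulSqrtTwo
local notation "Q" n:max => (Prod.fst (pellPair n) : ℤ)
local notation "H" n:max => (Prod.snd (pellPair n) : ℤ)

theorem sqrt_two_bounds : 1.414 < √2 ∧ √2 < 1.415 := by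
  constructor
  · exact Real.lt_sqrt_of_sq_lt (by norm_num)
  · rw [Real.sqrt_lt' (by norm_num)]; norm_num

theorem sqrt_two_mul_self : √2 * √2 = (2 : ℝ) := Real.mul_self_sqrt (by norm_num)

theorem int_mul_sqrt_two_ne {m : ℤ} (hm : m ≠ 0) (l : ℤ) : (m : ℝ) * √2 ≠ l := fun h =>
  ((irrational_sqrt_two.intCast_mul hm).ne_int l) h

theorem floorMulSqrtTwo_lt {m : ℤ} (hm : m ≠ 0) : (g m : ℝ) < m * √2 :=
  lt_of_le_of_ne (Int.floor_le _) (int_mul_sqrt_two_ne hm _).symm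

theorem lt_floorMulSqrtTwo_add_one (m : ℤ) : (m : ℝ) * √2 < g m + 1 := Int.lt_floor_add_one _

theorem floorMulSqrtTwo_eq {m l : ℤ} (h₁ : (l : ℝ) ≤ m * √2) (h₂ : (m : ℝ) * √2 < l + 1) :
    g m = l := Int.floor_eq_iff.2 ⟨h₁, h₂⟩

theorem floorMulSqrtTwo_succ (m : ℤ) : g m + 1 ≤ g (m + 1) ∧ g (m + 1) ≤ g m + 2 := by
  have hs := sqrt_two_bounds
  have h₁ : (g m : ℝ) ≤ m * √2 := Int.floor_le _
  have h₂ := lt_floorMulSqrtTwo_add_one m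
  constructor
  · refine Int.le_floor.2 ?_
    push_cast
    linarith
  · refine Int.lt_add_one_iff.1 (Int.floor_lt.2 ?_)
    push_cast
    linarith

theorem parityWord_eq_iff (m n : ℕ) :
    parityWord m = parityWord n ↔ Even (g (m + 1) - g (n + 1)) := by
  unfold parityWord
  rw [Int.even_sub]
  split_ifs with h₁ h₂ h₂ <;> simp [h₁, h₂]

/-! ### Diophantine approximation of `√2` -/

theorem pellPair_nonneg (n : ℕ) : 0 ≤ Q n ∧ 1 ≤ H n := by
  induction n with
  | zero => simp [pellPair]
  | succ n ih => simp only [pellPair]; omega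

theorem le_pellPair_snd (n : ℕ) : (n : ℤ) ≤ H n := by
  induction n with
  | zero => simp [pellPair]
  | succ n ih =>
    cases n with
    | zero => simp [pellPair]
    | succ n =>
      have := pellPair_nonneg n
      simp only [pellPair] at ih ⊢
      push_cast at ih ⊢
      omega

theorem pellPair_sub_sqrt_two_mul (n : ℕ) :
    (H n : ℝ) - √2 * Q n = (-1) ^ n * (√2 - 1) ^ n := by
  rw [← mul_pow]
  induction n with
  | zero => simp [pellPair]
  | succ n ih =>
    rw [pow_succ, ← ih]
    simp only [pellPair]
    push_cast
    linear_combination -(Q n : ℝ) * sqrt_two_mul_self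

theorem pellPair_det (n : ℕ) : H n * Q (n + 1) - Q n * H (n + 1) = (-1) ^ n := by
  induction n with
  | zero => simp [pellPair]
  | succ n ih =>
    rw [pow_succ, ← ih]
    simp only [pellPair]
    ring

theorem neg_one_pow_cases (n : ℕ) : ((-1 : ℝ) ^ n = 1 ∧ (-1 : ℤ) ^ n = 1) ∨
    ((-1 : ℝ) ^ n = -1 ∧ (-1 : ℤ) ^ n = -1) := by
  rcases n.even_or_odd with h | h
  · exact .inl ⟨h.neg_one_pow, h.neg_one_pow⟩
  · exact .inr ⟨h.neg_one_pow, h.neg_one_pow⟩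

theorem coeff_signs {a b u v : ℤ} (ha : 0 ≤ a) (h₀ : 0 < u * a + v * b) (h₁ : u * a + v * b < b) :
    (u ≤ -1 ∧ 1 ≤ v) ∨ (1 ≤ u ∧ v ≤ 0) := by
  rcases le_or_gt v 0 with hv | hv
  · refine .inr ⟨?_, hv⟩
    by_contra! hu
    nlinarith
  · refine .inl ⟨?_, hv⟩
    by_contra! hu
    nlinarith

theorem coeff_combination_bound {u v : ℤ} {e f : ℝ} (he : 0 ≤ e) (hf : 0 ≤ f)
    (h : (u ≤ -1 ∧ 1 ≤ v) ∨ (1 ≤ u ∧ v ≤ 0)) : u * e - v * f ≤ -e - f ∨ e ≤ u * e - v * f := by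
  rcases h with ⟨hu, hv⟩ | ⟨hu, hv⟩
  · left
    have hu : (u : ℝ) ≤ -1 := by exact_mod_cast hu
    have hv : (1 : ℝ) ≤ v := by exact_mod_cast hv
    nlinarith
  · right
    have hu : (1 : ℝ) ≤ u := by exact_mod_cast hu
    have hv : (v : ℝ) ≤ 0 := by exact_mod_cast hv
    nlinarith

/-- Every integer vector is an integer combination of two consecutive convergents. -/
theorem exists_pell_coeffs (n : ℕ) (j l : ℤ) : ∃ u v : ℤ,
    j = u * Q n + v * Q (n + 1) ∧ l = u * H n + v * H (n + 1) ∧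
    (-1) ^ n * ((l : ℝ) - √2 * j) = u * (√2 - 1) ^ n - v * (√2 - 1) ^ (n + 1) := by
  obtain ⟨u, v, hj, hl⟩ : ∃ u v : ℤ,
      j = u * Q n + v * Q (n + 1) ∧ l = u * H n + v * H (n + 1) := by
    have hdet := pellPair_det n
    rcases neg_one_pow_cases n with ⟨-, h⟩ | ⟨-, h⟩ <;> rw [h] at hdet
    · exact ⟨l * Q (n + 1) - j * H (n + 1), j * H n - l * Q n,
        by linear_combination -j * hdet, by linear_combination -l * hdet⟩
    · exact ⟨-(l * Q (n + 1) - j * H (n + 1)), -(j * H n - l * Q n),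
        by linear_combination j * hdet, by linear_combination l * hdet⟩
  refine ⟨u, v, hj, hl, ?_⟩
  have h₀ := pellPair_sub_sqrt_two_mul n
  have h₁ := pellPair_sub_sqrt_two_mul (n + 1)
  rw [pow_succ (-1 : ℝ)] at h₁
  have hl' : (l : ℝ) = u * H n + v * H (n + 1) := by exact_mod_cast hl
  have hj' : (j : ℝ) = u * Q n + v * Q (n + 1) := by exact_mod_cast hj
  have hdiff : (l : ℝ) - √2 * j = u * ((H n : ℝ) - √2 * Q n) +
      v * ((H (n + 1) : ℝ) - √2 * Q (n + 1)) := by rw [hl', hj']; ring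
  rw [hdiff, h₀, h₁]
  rcases neg_one_pow_cases n with ⟨h, -⟩ | ⟨h, -⟩ <;> rw [h] <;> ring

theorem sqrt_two_sub_one_pow_pos (n : ℕ) : 0 < (√2 - 1) ^ n :=
  pow_pos (by linarith [sqrt_two_bounds.1]) n

theorem le_abs_sub_sqrt_two_mul {n : ℕ} {p : ℤ} (h₀ : 0 < p) (h₁ : p < H (n + 1)) (k : ℤ) :
    (√2 - 1) ^ n ≤ |(p : ℝ) - √2 * k| := by
  obtain ⟨u, v, -, hp, hE⟩ := exists_pell_coeffs n k p
  have h := coeff_combination_bound (sqrt_two_sub_one_pow_pos n).le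
    (sqrt_two_sub_one_pow_pos (n + 1)).le
    (coeff_signs (zero_le_one.trans (pellPair_nonneg n).2) (hp ▸ h₀) (hp ▸ h₁))
  rw [← hE] at h
  have := sqrt_two_sub_one_pow_pos (n + 1)
  rw [le_abs]
  rcases neg_one_pow_cases n with ⟨hs, -⟩ | ⟨hs, -⟩ <;> rw [hs] at h <;>
    rcases h with h | h
  · right; linarith
  · left; linarith
  · left; linarith
  · right; linarith

theorem sub_sqrt_two_mul_bound {n : ℕ} {j : ℤ} (h₀ : 0 < j) (h₁ : j < Q (n + 1)) (l : ℤ) :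
    (-1) ^ n * ((l : ℝ) - √2 * j) ≤ -(√2 - 1) ^ n - (√2 - 1) ^ (n + 1) ∨
      (√2 - 1) ^ n ≤ (-1) ^ n * ((l : ℝ) - √2 * j) := by
  obtain ⟨u, v, hj, -, hE⟩ := exists_pell_coeffs n j l
  rw [hE]
  exact coeff_combination_bound (sqrt_two_sub_one_pow_pos n).le
    (sqrt_two_sub_one_pow_pos (n + 1)).le
    (coeff_signs (pellPair_nonneg n).1 (hj ▸ h₀) (hj ▸ h₁))

/-- Inside a window of `Q (n + 1)` indices the rotation by `√2` can always step backwards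
by a small amount. -/
theorem exists_small_step (n : ℕ) {a i : ℤ} (h₀ : a ≤ i) (h₁ : i < a + Q (n + 1)) :
    ∃ j z : ℤ, a ≤ j ∧ j < a + Q (n + 1) ∧ ∃ δ : ℝ, 0 < δ ∧ δ ≤ (√2 - 1) ^ n + (√2 - 1) ^ (n + 1) ∧
      (j : ℝ) * √2 = i * √2 - δ + z := by
  have e₀ := sqrt_two_sub_one_pow_pos n
  have e₁ := sqrt_two_sub_one_pow_pos (n + 1)
  have d₀ := pellPair_sub_sqrt_two_mul n
  have d₁ := pellPair_sub_sqrt_two_mul (n + 1)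
  rw [pow_succ (-1 : ℝ)] at d₁
  have hQ : 0 ≤ Q n := (pellPair_nonneg n).1
  have hQ' : Q n ≤ Q (n + 1) := by
    have := pellPair_nonneg n
    simp only [pellPair]; omega
  rcases neg_one_pow_cases n with ⟨hs, -⟩ | ⟨hs, -⟩ <;> rw [hs] at d₀ d₁
  · by_cases h : i + Q n < a + Q (n + 1)
    · refine ⟨i + Q n, H n, by omega, h, _, e₀, by linarith, ?_⟩
      push_cast
      linarith
    · refine ⟨i + Q n - Q (n + 1), H n - H (n + 1), by omega, by omega, _, add_pos e₀ e₁,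
        le_rfl, ?_⟩
      push_cast
      linarith
  · by_cases h : a ≤ i - Q n
    · refine ⟨i - Q n, - H n, by omega, by omega, _, e₀, by linarith, ?_⟩
      push_cast
      linarith
    · refine ⟨i - Q n + Q (n + 1), H (n + 1) - H n, by omega, by omega, _, add_pos e₀ e₁,
        le_rfl, ?_⟩
      push_cast
      linarith

theorem exists_fract_lt (n : ℕ) (c : ℝ) {η : ℝ} (hη : (√2 - 1) ^ n + (√2 - 1) ^ (n + 1) ≤ η)
    (a : ℤ) : ∃ i, a ≤ i ∧ i < a + Q (n + 1) ∧ Int.fract ((i : ℝ) * √2 - c) < η := by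
  have hne : (Finset.Ico a (a + Q (n + 1))).Nonempty := by
    have := pellPair_nonneg n
    rw [Finset.nonempty_Ico]
    simp only [pellPair]; omega
  obtain ⟨i, hi, hmin⟩ := Finset.exists_min_image _
    (fun i : ℤ => Int.fract ((i : ℝ) * √2 - c)) hne
  rw [Finset.mem_Ico] at hi
  refine ⟨i, hi.1, hi.2, ?_⟩
  by_contra! hcon
  obtain ⟨j, z, hj₀, hj₁, δ, hδ₀, hδ₁, hj⟩ := exists_small_step n hi.1 hi.2
  have hle := hmin j (Finset.mem_Ico.2 ⟨hj₀, hj₁⟩)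
  have : Int.fract ((j : ℝ) * √2 - c) = Int.fract ((i : ℝ) * √2 - c) - δ := by
    rw [Int.fract_eq_iff]
    refine ⟨by linarith, by linarith [Int.fract_lt_one ((i : ℝ) * √2 - c)],
      ⌊(i : ℝ) * √2 - c⌋ + z, ?_⟩
    push_cast
    rw [hj]
    linarith [Int.floor_add_fract ((i : ℝ) * √2 - c)]
  simp only [this] at hle
  linarith

theorem pow_add_pow_succ (n : ℕ) : (√2 - 1) ^ n + (√2 - 1) ^ (n + 1) = √2 * (√2 - 1) ^ n := by
  ring

/-- A run of matches at distance `p` is short compared with `p`. -/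
theorem add_lt_of_matches {a p m : ℤ} (hp : 0 < p)
    (h : ∀ i, a ≤ i → i < a + m → Even (g (i + p) - g i)) :
    (m + p : ℝ) < (2 + √2 / 2) * p := by
  have hs := sqrt_two_bounds
  have hs2 := sqrt_two_mul_self
  set k : ℤ := round ((p : ℝ) * √2 / 2) with hk
  set r : ℝ := p * √2 - 2 * k with hr
  have hr1 : |r| ≤ 1 := by
    have := abs_le.1 (abs_sub_round ((p : ℝ) * √2 / 2))
    rw [← hk] at this
    rw [abs_le]
    constructor <;> linarith
  have hr0 : 0 < |r| := by
    rw [abs_pos, hr, sub_ne_zero]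
    exact_mod_cast int_mul_sqrt_two_ne hp.ne' (2 * k)
  have hex : ∃ n : ℕ, √2 * (√2 - 1) ^ n ≤ |r| := by
    obtain ⟨n, hn⟩ := exists_pow_lt_of_lt_one (y := √2 - 1) (x := |r| / √2)
      (div_pos hr0 (by linarith)) (by linarith)
    rw [lt_div_iff₀ (by linarith)] at hn
    exact ⟨n, by linarith⟩
  classical
  obtain ⟨n, hn, hmin⟩ : ∃ n : ℕ, √2 * (√2 - 1) ^ n ≤ |r| ∧
      ∀ m < n, |r| < √2 * (√2 - 1) ^ m :=
    ⟨Nat.find hex, Nat.find_spec hex, fun m hm => not_le.1 (Nat.find_min hex hm)⟩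
  obtain ⟨n, rfl⟩ : ∃ n', n = n' + 1 := by
    refine Nat.exists_eq_succ_of_ne_zero ?_
    rintro rfl
    simp only [pow_zero] at hn
    linarith
  have hpH : H (n + 1) ≤ p := by
    by_contra! hlt
    have h₁ := le_abs_sub_sqrt_two_mul hp hlt k
    have h₂ := hmin n (Nat.lt_succ_self n)
    have h₃ : r = √2 * ((p : ℝ) - √2 * k) := by rw [hr]; linear_combination (k : ℝ) * hs2
    rw [h₃, abs_mul, abs_of_pos (by linarith : (0 : ℝ) < √2)] at h₂
    exact (not_lt.2 h₁) (lt_of_mul_lt_mul_left h₂ (by linarith))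
  have hm : m < Q (n + 1 + 1) := by
    by_contra! hle
    have hg : ∀ i : ℤ, g (i + p) = ⌊(i : ℝ) * √2 + r⌋ + 2 * k := by
      intro i
      rw [← Int.floor_add_intCast, floorMulSqrtTwo]
      congr 1
      push_cast
      rw [hr]; ring
    rcases le_or_gt r 0 with hneg | hpos
    · rw [abs_of_nonpos hneg] at hn hr1 hr0
      obtain ⟨i, h₀, h₁, h₂⟩ := exists_fract_lt (n + 1) 0 ((pow_add_pow_succ _).trans_le hn) a
      have he := h i h₀ (by omega)
      rw [sub_zero] at h₂
      have h₃ := Int.fract_nonneg ((i : ℝ) * √2)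
      have h₄ := Int.floor_add_fract ((i : ℝ) * √2)
      have : ⌊(i : ℝ) * √2 + r⌋ = g i - 1 := by
        rw [Int.floor_eq_iff, floorMulSqrtTwo]
        push_cast
        constructor <;> linarith
      rw [hg, this] at he
      obtain ⟨c, hc⟩ := he
      omega
    · rw [abs_of_pos hpos] at hn hr1
      obtain ⟨i, h₀, h₁, h₂⟩ := exists_fract_lt (n + 1) (-r) ((pow_add_pow_succ _).trans_le hn) a
      have he := h i h₀ (by omega)
      rw [sub_neg_eq_add] at h₂
      have h₃ := Int.fract_nonneg ((i : ℝ) * √2 + r)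
      have h₄ := Int.floor_add_fract ((i : ℝ) * √2 + r)
      have : g i = ⌊(i : ℝ) * √2 + r⌋ - 1 := by
        refine floorMulSqrtTwo_eq ?_ ?_ <;> push_cast <;> linarith
      rw [hg, this] at he
      obtain ⟨c, hc⟩ := he
      omega
  have hQ : Q (n + 1 + 1) = Q (n + 1) + H (n + 1) := rfl
  rw [hQ] at hm
  have hm' : (m : ℝ) + 1 ≤ Q (n + 1) + H (n + 1) := by exact_mod_cast hm
  have hpH' : (H (n + 1) : ℝ) ≤ p := by exact_mod_cast hpH
  have hd := pellPair_sub_sqrt_two_mul (n + 1)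
  have hα : (√2 - 1) ^ (n + 1) ≤ 1 := pow_le_one₀ (by linarith) (by linarith)
  have hα0 := sqrt_two_sub_one_pow_pos (n + 1)
  have hd' : √2 * Q (n + 1) - H (n + 1) ≤ 1 := by
    rcases neg_one_pow_cases (n + 1) with ⟨h, -⟩ | ⟨h, -⟩ <;> rw [h] at hd <;> linarith
  have key : (Q (n + 1) : ℝ) - 1 < √2 / 2 * H (n + 1) := by
    have h₁ := mul_le_mul_of_nonneg_left hd' (by linarith : (0 : ℝ) ≤ √2)
    rw [mul_sub, ← mul_assoc, hs2] at h₁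
    linarith
  nlinarith

theorem matches_pell (n : ℕ) {i : ℤ} (h₀ : Q n < i) (h₁ : i < Q n + Q (n + 1)) :
    g (i + H n) = g i + 2 * Q n := by
  have hs := sqrt_two_bounds
  have hs2 := sqrt_two_mul_self
  have e₀ := sqrt_two_sub_one_pow_pos n
  have e₁ := sqrt_two_sub_one_pow_pos (n + 1)
  have hsum := pow_add_pow_succ n
  have hlt : √2 * (√2 - 1) ^ n < 2 * (√2 - 1) ^ n := by nlinarith
  have hi : i ≠ 0 := by have := pellPair_nonneg n; omega
  have hl := floorMulSqrtTwo_lt hi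
  have hu := lt_floorMulSqrtTwo_add_one i
  have d₀ := pellPair_sub_sqrt_two_mul n
  have hH : (H n : ℝ) * √2 = 2 * Q n + √2 * ((-1) ^ n * (√2 - 1) ^ n) := by
    rw [← d₀]; linear_combination (Q n : ℝ) * hs2
  have b := fun M : ℤ => sub_sqrt_two_mul_bound (n := n) (j := i - Q n) (by omega) (by omega)
    (M - H n)
  apply floorMulSqrtTwo_eq
  all_goals
    push_cast at b ⊢
    rcases neg_one_pow_cases n with ⟨h, -⟩ | ⟨h, -⟩ <;> rw [h] at d₀ hH <;> simp only [h] at b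
  · nlinarith
  · rcases b (g i) with b | b <;> nlinarith
  · have b := b (g i + 1)
    push_cast at b
    rcases b with b | b <;> nlinarith
  · nlinarith

/-! ### Complete returns to palindromes -/

theorem eq_apply_zero_of_even {f : ℕ → ℤ} {n : ℕ} (hstep : ∀ k, k + 1 < n → |f (k + 1) - f k| ≤ 1)
    (heven : ∀ k < n, Even (f k)) : ∀ k < n, f k = f 0 := by
  intro k
  induction k with
  | zero => intro _; rfl
  | succ k ih =>
    intro hk
    have h₁ := abs_le.1 (hstep k hk)
    obtain ⟨c, hc⟩ := heven k (by omega)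
    obtain ⟨d, hd⟩ := heven (k + 1) hk
    have := ih (by omega)
    omega

theorem floor_sub_const {i j : ℤ} {n : ℕ} (h : ∀ k : ℕ, k < n → Even (g (j + k) - g (i + k))) :
    ∃ e : ℤ, ∀ k : ℕ, k < n → g (j + k) = g (i + k) + 2 * e := by
  rcases n.eq_zero_or_pos with rfl | hn
  · exact ⟨0, fun k hk => absurd hk (by omega)⟩
  have hc := eq_apply_zero_of_even (f := fun k : ℕ => g (j + k) - g (i + k)) (n := n) ?_ h
  · obtain ⟨e, he⟩ := h 0 hn
    refine ⟨e, fun k hk => ?_⟩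
    have := hc k hk
    omega
  · intro k _
    have h₁ := floorMulSqrtTwo_succ (i + k)
    have h₂ := floorMulSqrtTwo_succ (j + k)
    push_cast
    rw [abs_le, ← add_assoc, ← add_assoc]
    omega

theorem floor_add_const {i : ℤ} {n : ℕ}
    (h : ∀ k : ℕ, k < n → Even (g (i + k) + g (i + n - 1 - k))) :
    ∃ f : ℤ, ∀ k : ℕ, k < n → g (i + k) + g (i + n - 1 - k) = 2 * f := by
  rcases n.eq_zero_or_pos with rfl | hn
  · exact ⟨0, fun k hk => absurd hk (by omega)⟩
  have hc := eq_apply_zero_of_even (f := fun k : ℕ => g (i + k) + g (i + n - 1 - k)) (n := n) ?_ h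
  · obtain ⟨e, he⟩ := h 0 hn
    refine ⟨e, fun k hk => ?_⟩
    have := hc k hk
    omega
  · intro k _
    have h₁ := floorMulSqrtTwo_succ (i + k)
    have h₂ := floorMulSqrtTwo_succ (i + n - 1 - (k + 1))
    push_cast
    rw [show i + n - 1 - ((k : ℤ) + 1) + 1 = i + n - 1 - k by ring] at h₂
    rw [abs_le, ← add_assoc]
    omega

/-- A complete return to a palindrome is a palindrome. -/
theorem complete_return_palindrome {i j : ℤ} {n : ℕ} (hn : 0 < n) (hi : 0 < i) (hij : i < j)
    (hpal : ∀ k : ℕ, k < n → Even (g (i + k) + g (i + n - 1 - k)))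
    (hrep : ∀ k : ℕ, k < n → Even (g (j + k) - g (i + k)))
    (hno : ∀ m, i < m → m < j → ¬ ∀ k : ℕ, k < n → Even (g (m + k) - g (i + k)))
    (k : ℕ) (hk : k < n + (j - i)) : Even (g (i + k) + g (j + n - 1 - k)) := by
  obtain ⟨e, he⟩ := floor_sub_const hrep
  obtain ⟨f, hf⟩ := floor_add_const hpal
  have hsum : ∀ k : ℕ, k < n → g (i + k) + g (j + n - 1 - k) = 2 * f + 2 * e := by
    intro k hk
    have h₁ := he (n - 1 - k) (by omega)
    have h₂ := hf k hk
    rw [show j + ((n - 1 - k : ℕ) : ℤ) = j + n - 1 - k by omega,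
      show i + ((n - 1 - k : ℕ) : ℤ) = i + n - 1 - k by omega] at h₁
    omega
  by_cases hkn : k < n
  · exact ⟨f + e, by rw [hsum k hkn]; ring⟩
  by_cases hkd : j - i ≤ k
  · obtain ⟨k', hk'⟩ := Int.eq_ofNat_of_zero_le (show 0 ≤ j + n - 1 - k - i by omega)
    have := hsum k' (by omega)
    rw [show i + (k' : ℤ) = j + n - 1 - k by omega, show j + n - 1 - (k' : ℤ) = i + k by omega]
      at this
    exact ⟨f + e, by omega⟩
  push Not at hkn hkd
  -- `(A, B)` is the interval of starting points giving the same palindrome as position `i`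
  obtain ⟨s, hs, hmax⟩ := Finset.exists_max_image (Finset.range n)
    (fun k : ℕ => (g (i + k) : ℝ) - k * √2) ⟨0, Finset.mem_range.2 hn⟩
  rw [Finset.mem_range] at hs
  replace hmax : ∀ k : ℕ, k < n → (g (i + k) : ℝ) - k * √2 ≤ g (i + s) - s * √2 :=
    fun k hk => hmax k (Finset.mem_range.2 hk)
  set A : ℝ := g (i + s) - s * √2 with hA
  set B : ℝ := 2 * f + 1 - (n - 1) * √2 - A with hB
  have hmin : ∀ k : ℕ, k < n → B ≤ g (i + k) + 1 - k * √2 := by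
    intro k hk
    have h₁ := hmax (n - 1 - k) (by omega)
    have h₂ := hf k hk
    rw [show i + ((n - 1 - k : ℕ) : ℤ) = i + n - 1 - k by omega] at h₁
    have h₃ : ((n - 1 - k : ℕ) : ℝ) = n - 1 - k := by
      rw [Nat.cast_sub (by omega), Nat.cast_sub (by omega)]; simp
    have h₄ : (g (i + k) : ℝ) + g (i + n - 1 - k) = 2 * f := by exact_mod_cast h₂
    rw [h₃] at h₁
    rw [hB]
    linarith
  have hocc : ∀ m c : ℤ, i < m → m < j → A < m * √2 - 2 * c → m * √2 - 2 * c < B → False := by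
    intro m c him hmj hAm hmB
    refine hno m him hmj fun k hk => ⟨c, ?_⟩
    have : g (m + k) = g (i + k) + 2 * c := by
      have h₁ := hmax k hk
      have h₂ := hmin k hk
      refine floorMulSqrtTwo_eq ?_ ?_ <;> push_cast <;> linarith
    omega
  have hlow : ∀ m : ℤ, 0 < m → ∀ c : ℤ,
      (∀ k : ℕ, k < n → g (m + k) = g (i + k) + 2 * c) →
      A < m * √2 - 2 * c ∧ m * √2 - 2 * c < B := by
    intro m hm c hc
    have hlt : ∀ k : ℕ, k < n → (g (i + k) : ℝ) + 2 * c < (m + k) * √2 ∧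
        (m + k) * √2 < g (i + k) + 2 * c + 1 := by
      intro k hk
      have h₁ := floorMulSqrtTwo_lt (m := m + k) (by omega)
      have h₂ := lt_floorMulSqrtTwo_add_one (m + k)
      rw [hc k hk] at h₁ h₂
      push_cast at h₁ h₂
      exact ⟨h₁, h₂⟩
    constructor
    · have := (hlt s hs).1
      rw [hA]; linarith
    · have h₁ := (hlt (n - 1 - s) (by omega)).2
      have h₂ := hf s hs
      rw [show i + ((n - 1 - s : ℕ) : ℤ) = i + n - 1 - s by omega] at h₁
      have h₃ : ((n - 1 - s : ℕ) : ℝ) = n - 1 - s := by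
        rw [Nat.cast_sub (by omega), Nat.cast_sub (by omega)]; simp
      have h₄ : (g (i + s) : ℝ) + g (i + n - 1 - s) = 2 * f := by exact_mod_cast h₂
      rw [h₃] at h₁
      rw [hB, hA]; linarith
  obtain ⟨hiA, hiB⟩ := hlow i hi 0 (fun k _ => by ring)
  obtain ⟨hjA, hjB⟩ := hlow j (by omega) e he
  simp only [Int.cast_zero, mul_zero, sub_zero] at hiA hiB
  -- two endpoints of a short segment and their images under the rotation
  set Y : ℤ → ℝ := fun k => (i + k) * √2 with hY
  set Y' : ℤ → ℝ := fun k => 2 * f + 2 * e + 1 - (j + n - 1 - k) * √2 with hY'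
  have hYocc : ∀ (k c : ℤ), 0 < k → k < j - i → A < Y k - 2 * c → Y k - 2 * c < B → False := by
    intro k c h₀ h₁ h₂ h₃
    simp only [hY] at h₂ h₃
    exact hocc (i + k) c (by omega) (by omega) (by push_cast; exact h₂) (by push_cast; exact h₃)
  have hY'occ : ∀ (k c : ℤ), 0 < k → k < j - i → A < Y' k - 2 * c → Y' k - 2 * c < B → False := by
    intro k c h₀ h₁ h₂ h₃
    simp only [hY'] at h₂ h₃
    refine hocc (j - k) (e - c) (by omega) (by omega) ?_ ?_ <;> push_cast <;> linarith
  have hlen : ∀ k, Y k - Y' k < B - A ∧ Y' k - Y k < B - A := by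
    intro k
    simp only [hY, hY']
    constructor <;> linarith
  have hcross : ∀ (t : ℕ) (c : ℤ) (E : ℝ), t < n → (E = A ∨ E = B) →
      ¬ (Y k < E + 2 * c + t * √2 ∧ E + 2 * c + t * √2 < Y' k) ∧
      ¬ (Y' k < E + 2 * c + t * √2 ∧ E + 2 * c + t * √2 < Y k) := by
    intro t c E ht hE
    have hl := hlen k
    have hYt : Y (k - t) = Y k - t * √2 := by simp only [hY]; push_cast; ring
    have hYt' : Y' (k - t) = Y' k - t * √2 := by simp only [hY']; push_cast; ring
    have h₁ := hYocc (k - t) c (by omega) (by omega)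
    have h₂ := hY'occ (k - t) c (by omega) (by omega)
    rw [hYt] at h₁
    rw [hYt'] at h₂
    constructor <;> rintro ⟨h₃, h₄⟩ <;> rcases hE with rfl | rfl
    · exact h₂ (by linarith) (by linarith)
    · exact h₁ (by linarith) (by linarith)
    · exact h₁ (by linarith) (by linarith)
    · exact h₂ (by linarith) (by linarith)
  have hinteger : ∀ M : ℤ, ¬ (Y k < M ∧ (M : ℝ) < Y' k) ∧ ¬ (Y' k < M ∧ (M : ℝ) < Y k) := by
    intro M
    rcases Int.even_or_odd' (M - g (i + s)) with ⟨c, hc | hc⟩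
    · have := hcross s c A hs (.inl rfl)
      have hM : (M : ℝ) = A + 2 * c + s * √2 := by
        have : (M : ℝ) - g (i + s) = 2 * c := by exact_mod_cast hc
        rw [hA]; linarith
      rwa [← hM] at this
    · have := hcross (n - 1 - s) (c + g (i + s) - f) B (by omega) (.inr rfl)
      have hM : (M : ℝ) = B + 2 * (c + g (i + s) - f : ℤ) + (n - 1 - s : ℕ) * √2 := by
        have : (M : ℝ) - g (i + s) = 2 * c + 1 := by exact_mod_cast hc
        have h₃ : ((n - 1 - s : ℕ) : ℝ) = n - 1 - s := by
          rw [Nat.cast_sub (by omega), Nat.cast_sub (by omega)]; simp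
        rw [h₃, hB, hA]
        push_cast
        linarith
      rwa [← hM] at this
  have y₁ := floorMulSqrtTwo_lt (m := i + k) (by omega)
  have y₂ := lt_floorMulSqrtTwo_add_one (i + k)
  have y₃ := floorMulSqrtTwo_lt (m := j + n - 1 - k) (by omega)
  have y₄ := lt_floorMulSqrtTwo_add_one (j + n - 1 - k)
  suffices g (i + k) + g (j + n - 1 - k) = 2 * f + 2 * e from ⟨f + e, by omega⟩
  set a := g (i + k)
  set b := g (j + n - 1 - k)
  push_cast at y₁ y₂ y₃ y₄
  rcases lt_trichotomy (a + b) (2 * f + 2 * e) with hlt | heq | hgt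
  · have hlt' : (a : ℝ) + b + 1 ≤ 2 * f + 2 * e := by exact_mod_cast hlt
    refine absurd ⟨?_, ?_⟩ (hinteger (a + 1)).1 <;> simp only [hY, hY'] <;> push_cast <;> linarith
  · exact heq
  · have hgt' : (2 : ℝ) * f + 2 * e + 1 ≤ a + b := by exact_mod_cast hgt
    refine absurd ⟨?_, ?_⟩ (hinteger a).2 <;> simp only [hY, hY'] <;> push_cast <;> linarith

/-! ### Richness -/

/-- Appending a letter to a rich word gives a rich word as soon as it completes a palindromic
suffix that did not occur before. -/
theorem Rich.concat {α : Type*} {w v : List α} {c : α} (hw : Rich w) (hv : v ≠ [])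
    (hpal : v.reverse = v) (hsuf : v <:+ w ++ [c]) (hnew : ¬ v <:+: w) : Rich (w ++ [c]) := by
  have hfin : {u : List α | u ≠ [] ∧ u <:+: w ∧ u.reverse = u}.Finite :=
    (List.finite_toSet w.sublists).subset fun u hu => List.mem_sublists.2 hu.2.1.sublist
  have hset : {u : List α | u ≠ [] ∧ u <:+: w ++ [c] ∧ u.reverse = u} =
      insert v {u : List α | u ≠ [] ∧ u <:+: w ∧ u.reverse = u} := by
    have key : ∀ {s t : List α}, s.reverse = s → t.reverse = t → t <:+ w ++ [c] → s <:+ t →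
        s = t ∨ s <:+: w := by
      intro s t hs ht htw hst
      have hpre : s <+: t := by
        rw [← List.reverse_suffix, hs, ht]; exact hst
      obtain ⟨r, rfl⟩ := hpre
      rcases r.eq_nil_or_concat with rfl | ⟨r, d, rfl⟩
      · simp
      · right
        obtain ⟨q, hq⟩ := htw
        rw [List.concat_eq_append, ← List.append_assoc, ← List.append_assoc] at hq
        exact ⟨q, r, (List.append_inj' hq rfl).1⟩
    ext u
    simp only [Set.mem_ofPred_eq, Set.mem_insert_iff]
    constructor
    · rintro ⟨hu, huw, hup⟩
      rcases List.infix_concat_iff.1 huw with h | h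
      · rcases List.suffix_or_suffix_of_suffix h hsuf with h' | h'
        · exact (key hup hpal hsuf h').imp id fun h => ⟨hu, h, hup⟩
        · rcases key hpal hup h h' with h | h
          · exact .inl h.symm
          · exact absurd h hnew
      · exact .inr ⟨hu, h, hup⟩
    · rintro (rfl | ⟨hu, huw, hup⟩)
      · exact ⟨hv, hsuf.isInfix, hpal⟩
      · exact ⟨hu, huw.trans (List.prefix_append w [c]).isInfix, hup⟩
  rw [Rich, hset, Set.ncard_insert_of_notMem (fun h => hnew h.2.1) hfin, hw]
  simp

/-- The factor of length `n` at position `a` of an infinite word. -/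
def window {α : Type*} (x : ℕ → α) (a n : ℕ) : List α :=
  (List.range n).map fun k => x (a + k)

theorem length_window {α : Type*} (x : ℕ → α) (a n : ℕ) : (window x a n).length = n := by
  simp [window]

theorem getElem_window {α : Type*} (x : ℕ → α) (a n k : ℕ) (h : k < (window x a n).length) :
    (window x a n)[k] = x (a + k) := by
  simp [window]

theorem getElem?_window {α : Type*} (x : ℕ → α) (a : ℕ) {n k : ℕ} (h : k < n) :
    (window x a n)[k]? = some (x (a + k)) := by
  simp [window, h]

theorem window_succ {α : Type*} (x : ℕ → α) (a n : ℕ) :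
    window x a (n + 1) = window x a n ++ [x (a + n)] := by
  simp [window, List.range_succ]

theorem window_eq_iff {α : Type*} (x : ℕ → α) (a b n : ℕ) :
    window x a n = window x b n ↔ ∀ k < n, x (a + k) = x (b + k) := by
  simp [window, List.map_inj_left]

theorem reverse_window_eq_iff {α : Type*} (x : ℕ → α) (a n : ℕ) :
    (window x a n).reverse = window x a n ↔ ∀ k < n, x (a + (n - 1 - k)) = x (a + k) := by
  constructor
  · intro h k hk
    have := congrArg (fun l => l[k]?) h
    simpa [List.getElem?_reverse, length_window, hk, getElem?_window,
      show n - 1 - k < n by omega, getElem_window] using this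
  · intro h
    refine List.ext_getElem (by simp) fun k h₁ h₂ => ?_
    rw [List.getElem_reverse, getElem_window, getElem_window, length_window]
    exact h k (by simpa [length_window] using h₂)

theorem window_add {α : Type*} (x : ℕ → α) (a m n : ℕ) :
    window x a (m + n) = window x a m ++ window x (a + m) n := by
  simp [window, List.range_add, Function.comp_def, add_assoc]

theorem exists_of_infix_window {α : Type*} {x : ℕ → α} {a n : ℕ} {u : List α}
    (h : u <:+: window x a n) : ∃ t, t + u.length ≤ n ∧ u = window x (a + t) u.length := by
  obtain ⟨s, e, h⟩ := h
  have hlen := congrArg List.length h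
  simp only [List.length_append, length_window] at hlen
  refine ⟨s.length, by omega, ?_⟩
  obtain ⟨r, rfl⟩ : ∃ r, n = s.length + u.length + r := ⟨_, hlen.symm⟩
  rw [window_add, window_add] at h
  have h₁ := List.append_inj h (by simp [length_window])
  exact (List.append_inj h₁.1 (by simp [length_window])).2

theorem parityWord_window_palindrome_iff (a n : ℕ) :
    (window parityWord a n).reverse = window parityWord a n ↔
      ∀ k : ℕ, k < n → Even (g ((a : ℤ) + 1 + k) + g ((a : ℤ) + 1 + n - 1 - k)) := by
  rw [reverse_window_eq_iff]
  refine forall₂_congr fun k hk => ?_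
  rw [eq_comm, parityWord_eq_iff, Int.even_sub, Int.even_add,
    show ((a + k : ℕ) : ℤ) + 1 = a + 1 + k by push_cast; ring,
    show ((a + (n - 1 - k) : ℕ) : ℤ) + 1 = a + 1 + n - 1 - k by omega]

theorem parityWord_window_eq_iff (a b n : ℕ) :
    window parityWord a n = window parityWord b n ↔
      ∀ k : ℕ, k < n → Even (g ((a : ℤ) + 1 + k) - g ((b : ℤ) + 1 + k)) := by
  rw [window_eq_iff]
  refine forall₂_congr fun k _ => ?_
  rw [parityWord_eq_iff, show ((a + k : ℕ) : ℤ) + 1 = a + 1 + k by push_cast; ring,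
    show ((b + k : ℕ) : ℤ) + 1 = b + 1 + k by push_cast; ring]

theorem rich_window_parityWord (a n : ℕ) : Rich (window parityWord a n) := by
  induction n with
  | zero =>
    have : {u : List (Fin 2) | u ≠ [] ∧ u <:+: window parityWord a 0 ∧ u.reverse = u} = ∅ := by
      ext u
      simp +contextual [window]
    simp [Rich, this, length_window]
  | succ n ih =>
    classical
    have hex : ∃ t, t ≤ n ∧ (window parityWord (a + t) (n + 1 - t)).reverse =
        window parityWord (a + t) (n + 1 - t) := ⟨n, le_rfl, by simp [window]⟩
    obtain ⟨t, ⟨htn, hpal⟩, hmin⟩ : ∃ t, (t ≤ n ∧ (window parityWord (a + t) (n + 1 - t)).reverse =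
        window parityWord (a + t) (n + 1 - t)) ∧ ∀ r < t, ¬ (r ≤ n ∧
        (window parityWord (a + r) (n + 1 - r)).reverse = window parityWord (a + r) (n + 1 - r)) :=
      ⟨Nat.find hex, Nat.find_spec hex, fun _ h => Nat.find_min hex h⟩
    rw [window_succ]
    refine ih.concat (v := window parityWord (a + t) (n + 1 - t)) ?_ hpal ?_ ?_
    · rw [← List.length_pos_iff, length_window]; omega
    · rw [← window_succ, show window parityWord a (n + 1) = window parityWord a (t + (n + 1 - t)) by
        congr 1; omega, window_add]
      exact List.suffix_append _ _
    · intro hinf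
      obtain ⟨r₀, hr₀, hr₀'⟩ := exists_of_infix_window hinf
      rw [length_window] at hr₀ hr₀'
      set P : ℕ → Prop := fun r => r < t ∧ window parityWord (a + t) (n + 1 - t) =
        window parityWord (a + r) (n + 1 - t) with hP
      have hP₀ : P r₀ := ⟨by omega, hr₀'⟩
      obtain ⟨hr, hrw⟩ : P (Nat.findGreatest P t) := Nat.findGreatest_spec (by omega) hP₀
      have hgreat : ∀ m, Nat.findGreatest P t < m → m ≤ t → ¬ P m :=
        fun m h₁ h₂ => Nat.findGreatest_is_greatest h₁ h₂
      set r := Nat.findGreatest P t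
      refine hmin r hr ⟨by omega, ?_⟩
      have hpal' := hrw ▸ hpal
      rw [parityWord_window_palindrome_iff] at hpal' ⊢
      intro k hk
      have := complete_return_palindrome (i := (a + r : ℕ) + 1) (j := (a + t : ℕ) + 1)
        (n := n + 1 - t) (by omega) (by omega) (by omega) hpal'
        ((parityWord_window_eq_iff _ _ _).1 hrw) ?_ k (by omega)
      · convert this using 3
        omega
      · intro m h₁ h₂ h₃
        obtain ⟨m', hm'⟩ := Int.eq_ofNat_of_zero_le (show 0 ≤ m - 1 - a by omega)
        obtain rfl : m = (a + m' : ℕ) + 1 := by push_cast; omega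
        refine hgreat m' (by omega) (by omega) ⟨by omega, ?_⟩
        rw [hrw]
        exact ((parityWord_window_eq_iff _ _ _).2 h₃).symm

/-! ### Exponents -/

theorem exponent_parityWord_lt {u : List (Fin 2)} {p : ℕ} (hu : FactorOfInf u parityWord)
    (hp : IsPeriod u p) : (u.length : ℝ) / p < 2 + √2 / 2 := by
  obtain ⟨a, ha⟩ := hu
  obtain ⟨hp₀, hpu, hper⟩ := hp
  change u = window parityWord a u.length at ha
  have hp' : (0 : ℝ) < p := by exact_mod_cast hp₀
  rw [div_lt_iff₀ hp']
  have := add_lt_of_matches (a := a + 1) (p := p) (m := u.length - p) (by exact_mod_cast hp₀) ?_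
  · push_cast at this
    linarith
  · intro i h₁ h₂
    obtain ⟨k, hk⟩ := Int.eq_ofNat_of_zero_le (show 0 ≤ i - 1 - a by omega)
    have h := hper k (by omega)
    rw [ha, getElem?_window _ _ (by omega), getElem?_window _ _ (by omega), Option.some_inj,
      eq_comm, parityWord_eq_iff] at h
    convert h using 3 <;> push_cast <;> omega

theorem exists_exponent_parityWord_gt {ε : ℝ} (hε : 0 < ε) : ∃ (u : List (Fin 2)) (p : ℕ),
    u ≠ [] ∧ FactorOfInf u parityWord ∧ IsPeriod u p ∧
      (u.length : ℝ) / p > 2 + √2 / 2 - ε := by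
  have hs := sqrt_two_bounds
  obtain ⟨n, hn⟩ := exists_nat_gt (2 / ε)
  rw [div_lt_iff₀ hε] at hn
  obtain ⟨hQ, hH⟩ := pellPair_nonneg n
  have hnH : (n : ℝ) ≤ H n := by exact_mod_cast le_pellPair_snd n
  have hd := pellPair_sub_sqrt_two_mul n
  have hα : (√2 - 1) ^ n ≤ 1 := pow_le_one₀ (by linarith) (by linarith)
  have hα₀ := sqrt_two_sub_one_pow_pos n
  have hm := fun i => matches_pell n (i := i)
  rw [show Q (n + 1) = Q n + H n from rfl] at hm
  generalize Q n = q at *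
  generalize H n = h at *
  lift q to ℕ using hQ
  lift h to ℕ using by omega
  refine ⟨window parityWord q (2 * h + q - 1), h, ?_, ⟨q, by simp [window]⟩, ⟨by omega, ?_, ?_⟩, ?_⟩
  · rw [← List.length_pos_iff, length_window]; omega
  · rw [length_window]; omega
  · intro i hi
    rw [length_window] at hi
    rw [getElem?_window _ _ (by omega), getElem?_window _ _ (by omega), Option.some_inj,
      eq_comm, parityWord_eq_iff]
    have := hm (q + i + 1) (by omega) (by omega)
    refine ⟨q, ?_⟩
    push_cast
    rw [show (q : ℤ) + (i + h) + 1 = q + i + 1 + h by ring]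
    omega
  · have hh : (0 : ℝ) < h := by
      have : (1 : ℝ) ≤ h := by exact_mod_cast hH
      linarith
    rw [length_window, gt_iff_lt, lt_div_iff₀ hh, Nat.cast_sub (by omega)]
    push_cast at hd hnH ⊢
    have h₁ : -1 ≤ √2 * q - h := by
      rcases neg_one_pow_cases n with ⟨h, -⟩ | ⟨h, -⟩ <;> rw [h] at hd <;> linarith
    have h₂ := mul_le_mul_of_nonneg_left h₁ (by linarith : (0 : ℝ) ≤ √2)
    rw [mul_sub, ← mul_assoc, sqrt_two_mul_self] at h₂
    have h₃ := mul_le_mul_of_nonneg_right hnH hε.le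
    linarith

theorem stmt18 :
    ∃ x : ℕ → Fin 2,
      (∀ u : List (Fin 2), FactorOfInf u x → Rich u) ∧
      sSup {e : ℝ | ∃ (u : List (Fin 2)) (p : ℕ),
          u ≠ [] ∧ FactorOfInf u x ∧ IsPeriod u p ∧ e = (u.length : ℝ) / p}
        = 2 + Real.sqrt 2 / 2 ∧
      (∀ (u : List (Fin 2)) (p : ℕ), u ≠ [] → FactorOfInf u x → IsPeriod u p →
        (u.length : ℝ) / p < 2 + Real.sqrt 2 / 2) ∧
      (∀ ε : ℝ, 0 < ε → ∃ (u : List (Fin 2)) (p : ℕ),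
        u ≠ [] ∧ FactorOfInf u x ∧ IsPeriod u p ∧
        (u.length : ℝ) / p > 2 + Real.sqrt 2 / 2 - ε) := by
  refine ⟨parityWord, ?_, ?_, fun u p _ => exponent_parityWord_lt,
    fun ε => exists_exponent_parityWord_gt⟩
  · rintro u ⟨a, ha⟩
    rw [ha]
    exact rich_window_parityWord a u.length
  · refine csSup_eq_of_forall_le_of_forall_lt_exists_gt ?_ ?_ ?_
    · obtain ⟨u, p, h₁, h₂, h₃, -⟩ := exists_exponent_parityWord_gt one_pos
      exact ⟨_, u, p, h₁, h₂, h₃, rfl⟩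
    · rintro e ⟨u, p, -, h₂, h₃, rfl⟩
      exact (exponent_parityWord_lt h₂ h₃).le
    · intro w hw
      obtain ⟨u, p, h₁, h₂, h₃, h₄⟩ := exists_exponent_parityWord_gt (sub_pos.2 hw)
      exact ⟨_, ⟨u, p, h₁, h₂, h₃, rfl⟩, by linarith⟩
end
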